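/- arXiv:2104.12368 — 2 statements merged into one kernel-verified Lean document; each statement's English description precedes it below -/
import Mathlib

section
/- Assume K¹,K² are bounded kernels with sup_{x∈T} K^i(x,x) ≤ κ_i², and define for positive self-adjoint trace-class operators (or positive semi-definite matrices) A,B the quantity W₂²(A,B) := tr(A) + tr(B) − 2 tr[(A^{1/2} B A^{1/2})^{1/2}] (the squared 2-Wasserstein distance between N(0,A) and N(0,B)). Then: (i) W₂²(C_{K¹}, C_{K²}) = tr(L_{K¹}) + tr(L_{K²}) − 2 tr[(R_{12}* R_{12})^{1/2}]; (ii) W₂²((1/m)K¹[X], (1/m)K²[X]) = tr(L_{K¹,X}) + tr(L_{K²,X}) − 2 tr[(R_{12,X}* R_{12,X})^{1/2}] for any X ∈ T^m; and (iii) if additionally dim(H_{K²}) < ∞ and X = (x_1,…,x_m) is sampled independently from (T,ν), then for every 0 < δ < 1, with probability at least 1−δ, |W₂²((1/m)K¹[X], (1/m)K²[X]) − W₂²(C_{K¹}, C_{K²})| ≤ (κ_1²+κ_2²)[2log(6/δ)/m + √(2log(6/δ)/m)] + 2√2 κ_1 κ_2 √(dim H_{K²}) · √(2log(6/δ)/m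 + √(2log(6/δ)/m)). -/
/- STATEMENT 6: bounded kernels `sup_x K^i(x,x) ≤ κ_i²`.  With
`W₂²(A,B) = tr A + tr B − 2 tr[(A^{1/2} B A^{1/2})^{1/2}]` (square roots encoded as the
unique positive operators/PSD matrices squaring to the given ones; operator traces along
Hilbert bases):
(i) `W₂²(C_{K¹},C_{K²}) = tr L_{K¹} + tr L_{K²} − 2 tr[(R₁₂* R₁₂)^{1/2}]`;
(ii) `W₂²((1/m)K¹[X],(1/m)K²[X]) = tr L_{K¹,X} + tr L_{K²,X} − 2 tr[(R₁₂,X* R₁₂,X)^{1/2}]`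
for every `X ∈ T^m`;
(iii) if moreover `dim H_{K²} < ∞` and `X` is i.i.d. from `ν`, then for `0 < δ < 1`, with
probability at least `1−δ`,
`|W₂²((1/m)K¹[X],(1/m)K²[X]) − W₂²(C_{K¹},C_{K²})|
   ≤ (κ₁²+κ₂²)[2log(6/δ)/m + √(2log(6/δ)/m)]
     + 2√2 κ₁κ₂ √(dim H_{K²}) √(2log(6/δ)/m + √(2log(6/δ)/m))`. -/

open MeasureTheory
open scoped RealInnerProductSpace

noncomputable section

theorem sum_range_catalan_div_le (N : ℕ) :
    ∑ n ∈ Finset.range N, (catalan n : ℝ) / 4 ^ n ≤ 2 := by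
  induction N with
  | zero => simp
  | succ N ih =>
    have h0 : 0 ≤ ∑ n ∈ Finset.range N, (catalan n : ℝ) / 4 ^ n :=
      Finset.sum_nonneg fun _ _ => by positivity
    have h1 : ∑ n ∈ Finset.range N, (catalan (n + 1) : ℝ) / 4 ^ (n + 1) ≤
        (∑ n ∈ Finset.range N, (catalan n : ℝ) / 4 ^ n) *
          (∑ n ∈ Finset.range N, (catalan n : ℝ) / 4 ^ n) / 4 := by
      rw [Finset.sum_mul_sum, ← Finset.sum_product', Finset.sum_div]
      have : ∀ n, (catalan (n + 1) : ℝ) / 4 ^ (n + 1) =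
          ∑ ij ∈ Finset.HasAntidiagonal.antidiagonal n,
            (catalan ij.1 : ℝ) / 4 ^ ij.1 * ((catalan ij.2 : ℝ) / 4 ^ ij.2) / 4 := by
        intro n
        rw [catalan_succ']
        push_cast
        rw [Finset.sum_div]
        refine Finset.sum_congr rfl fun ij hij => ?_
        rw [← Finset.HasAntidiagonal.mem_antidiagonal.1 hij]
        field_simp
        ring
      simp_rw [this]
      rw [← Finset.sum_biUnion]
      · refine Finset.sum_le_sum_of_subset_of_nonneg ?_ fun _ _ _ => by positivity
        intro ij
        simp only [Finset.mem_biUnion, Finset.mem_range, Finset.HasAntidiagonal.mem_antidiagonal,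
          Finset.mem_product]
        omega
      · intro a _ b _ hab
        refine Finset.disjoint_left.2 fun ij h1 h2 => hab ?_
        rw [← Finset.HasAntidiagonal.mem_antidiagonal.1 h1,
          ← Finset.HasAntidiagonal.mem_antidiagonal.1 h2]
    rw [Finset.sum_range_succ']
    simp only [catalan_zero, pow_zero, Nat.cast_one, div_one]
    nlinarith

theorem summable_catalan_div : Summable fun n : ℕ => (catalan n : ℝ) / 4 ^ n :=
  summable_of_sum_range_le (fun _ => by positivity) sum_range_catalan_div_le

/-- The square root of `1 - b` for `‖b‖ ≤ 1` in a Banach algebra, given by the power series of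
the Catalan numbers. -/
theorem exists_sq_eq_one_sub {R : Type*} [NormedRing R] [NormedAlgebra ℝ R] [NormOneClass R]
    [CompleteSpace R] (b : R) (hb : ‖b‖ ≤ 1) :
    ∃ c : R, ‖c‖ ≤ 1 ∧ (1 - c) * (1 - c) = 1 - b ∧ c ∈ closure (Algebra.adjoin ℝ {b} : Set R) := by
  set u : ℕ → R := fun n => ((catalan n : ℝ) / 4 ^ n) • b ^ n with hu
  have hun : ∀ n, ‖u n‖ ≤ (catalan n : ℝ) / 4 ^ n := by
    intro n
    rw [hu, norm_smul, Real.norm_of_nonneg (by positivity)]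
    have : ‖b ^ n‖ ≤ 1 := (norm_pow_le b n).trans (pow_le_one₀ (norm_nonneg _) hb)
    exact mul_le_of_le_one_right (by positivity) this
  have hus : Summable fun n => ‖u n‖ :=
    Summable.of_nonneg_of_le (fun _ => norm_nonneg _) hun summable_catalan_div
  set s := ∑' n, u n with hs
  have hsn : ‖s‖ ≤ 2 := by
    refine (norm_tsum_le_tsum_norm hus).trans ?_
    refine (hus.tsum_le_tsum hun summable_catalan_div).trans ?_
    exact Real.tsum_le_of_sum_range_le (fun _ => by positivity) sum_range_catalan_div_le
  have hss : s * s = ∑' n, ∑ ij ∈ Finset.HasAntidiagonal.antidiagonal n, u ij.1 * u ij.2 :=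
    tsum_mul_tsum_eq_tsum_sum_antidiagonal_of_summable_norm hus hus
  have hrec : ∀ n, u (n + 1) = (1 / 4 : ℝ) •
      (b * ∑ ij ∈ Finset.HasAntidiagonal.antidiagonal n, u ij.1 * u ij.2) := by
    intro n
    have : ∀ ij ∈ Finset.HasAntidiagonal.antidiagonal n, u ij.1 * u ij.2 =
        ((catalan ij.1 * catalan ij.2 : ℝ) / 4 ^ n) • b ^ n := by
      intro ij hij
      rw [← Finset.HasAntidiagonal.mem_antidiagonal.1 hij]
      simp only [hu, smul_mul_smul_comm, pow_add]
      congr 1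
      field_simp
    rw [Finset.sum_congr rfl this, ← Finset.sum_smul, mul_smul_comm, smul_smul, ← pow_succ']
    simp only [hu]
    congr 1
    rw [catalan_succ']
    push_cast
    rw [← Finset.sum_div]
    field_simp
    ring
  have hs1 : s = 1 + (1 / 4 : ℝ) • (b * (s * s)) := by
    have h0 : s = u 0 + ∑' n, u (n + 1) := hus.of_norm.tsum_eq_zero_add
    have hsum : Summable fun n =>
        ∑ ij ∈ Finset.HasAntidiagonal.antidiagonal n, u ij.1 * u ij.2 :=
      (summable_norm_sum_mul_antidiagonal_of_summable_norm hus hus).of_norm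
    rw [hss, ← hsum.tsum_mul_left, ← (hsum.mul_left b).tsum_const_smul, h0,
      show u 0 = 1 by simp [hu]]
    simp_rw [hrec]
  have hbs : Commute b s := by
    refine Commute.tsum_right _ fun n => ?_
    exact ((Commute.refl b).pow_right n).smul_right _
  refine ⟨(1 / 2 : ℝ) • (b * s), ?_, ?_, ?_⟩
  · rw [norm_smul]
    have := norm_mul_le b s
    have h2 : ‖b‖ * ‖s‖ ≤ 1 * 2 := mul_le_mul hb hsn (norm_nonneg _) zero_le_one
    norm_num
    linarith
  · have h3 : (1 / 4 : ℝ) • (b * (b * (s * s))) = b * s - b := by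
      conv_rhs => rw [hs1]
      simp [mul_add]
    have h4 : (b * s) * (b * s) = b * (b * (s * s)) := by
      rw [mul_assoc, ← mul_assoc s b s, ← hbs.eq, mul_assoc b s s]
    rw [sub_mul, mul_sub, mul_sub, smul_mul_smul_comm, h4, show (1/2 * (1/2) : ℝ) = 1/4 by norm_num,
      h3, one_mul, mul_one, one_mul]
    module
  · set S := (Algebra.adjoin ℝ {b}).topologicalClosure
    have hbS : b ∈ S := subset_closure (Algebra.subset_adjoin rfl)
    have hsS : s ∈ S := by
      refine (Subalgebra.isClosed_topologicalClosure _).mem_of_tendsto hus.of_norm.hasSum ?_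
      filter_upwards with t
      exact S.sum_mem fun i _ => S.smul_mem (S.pow_mem hbS _) _
    exact S.smul_mem (S.mul_mem hbS hsS) _

section PositiveOperators

variable {E : Type*} [NormedAddCommGroup E] [InnerProductSpace ℝ E]

namespace ContinuousLinearMap

theorem IsPositive.norm_apply_sq_le {A : E →L[ℝ] E} (hA : A.IsPositive) (x : E) :
    ‖A x‖ ^ 2 ≤ ‖A‖ * ⟪A x, x⟫ := by
  rcases eq_or_ne ‖A‖ 0 with h | h
  · simp [norm_eq_zero.1 h]
  have hpos : 0 < ‖A‖ := lt_of_le_of_ne (norm_nonneg _) h.symm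
  have h1 : 0 ≤ ⟪A (‖A‖ • x - A x), ‖A‖ • x - A x⟫ := hA.inner_nonneg_left _
  have h2 : ⟪A (A x), A x⟫ ≤ ‖A‖ * ‖A x‖ ^ 2 := by
    refine (real_inner_le_norm _ _).trans ?_
    nlinarith [A.le_opNorm (A x), norm_nonneg (A x)]
  have h3 : ⟪A (A x), x⟫ = ‖A x‖ ^ 2 := by
    rw [hA.inner_left_eq_inner_right, real_inner_self_eq_norm_sq]
  simp only [map_sub, map_smul, inner_sub_left, inner_sub_right, real_inner_smul_left,
    real_inner_smul_right, h3, real_inner_self_eq_norm_sq] at h1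
  have h4 : 0 ≤ ‖A‖ * (‖A‖ * ⟪A x, x⟫ - ‖A x‖ ^ 2) := by nlinarith
  have := nonneg_of_mul_nonneg_right h4 hpos
  linarith

theorem IsPositive.apply_eq_zero_of_inner {A : E →L[ℝ] E} (hA : A.IsPositive) {x : E}
    (hx : ⟪A x, x⟫ = 0) : A x = 0 := by
  have := hA.norm_apply_sq_le x
  rw [hx, mul_zero] at this
  exact norm_eq_zero.1 (pow_eq_zero_iff two_ne_zero |>.1 (le_antisymm this (by positivity)))

end ContinuousLinearMap

theorem ofReal_norm_sq_eq_tsum_inner_sq {ι : Type*} (e : HilbertBasis ι ℝ E) (x : E) :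
    ENNReal.ofReal (‖x‖ ^ 2) = ∑' i, ENNReal.ofReal (⟪x, e i⟫ ^ 2) := by
  have h := e.hasSum_inner_mul_inner x x
  rw [real_inner_self_eq_norm_sq] at h
  have h' : HasSum (fun i => ⟪x, e i⟫ ^ 2) (‖x‖ ^ 2) := by
    simpa only [real_inner_comm x, ← sq] using h
  rw [← h'.tsum_eq, ENNReal.ofReal_tsum_of_nonneg (fun _ => sq_nonneg _) h'.summable]

variable [CompleteSpace E]
  {F : Type*} [NormedAddCommGroup F] [InnerProductSpace ℝ F] [CompleteSpace F]

namespace ContinuousLinearMap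

theorem IsPositive.exists_sqrt {A : E →L[ℝ] E} (hA : A.IsPositive) :
    ∃ P : E →L[ℝ] E, P.IsPositive ∧ P * P = A ∧ ∀ C, Commute C A → Commute C P := by
  rcases eq_or_ne A 0 with rfl | h
  · exact ⟨0, isPositive_zero, by simp, fun C _ => Commute.zero_right C⟩
  have : Nontrivial E := by
    by_contra hE
    rw [not_nontrivial_iff_subsingleton] at hE
    exact h (Subsingleton.elim _ _)
  have hpos : 0 < ‖A‖ := norm_pos_iff.2 h
  set b : E →L[ℝ] E := 1 - ‖A‖⁻¹ • A with hb
  have hb1 : ‖b‖ ≤ 1 := by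
    refine opNorm_le_bound _ zero_le_one fun x => ?_
    rw [one_mul]
    refine le_of_sq_le_sq ?_ (norm_nonneg _)
    have h1 := hA.norm_apply_sq_le x
    have h2 := hA.inner_nonneg_left x
    simp only [hb, sub_apply, one_apply_eq_self, smul_apply]
    rw [norm_sub_sq_real, norm_smul, real_inner_smul_right, real_inner_comm, mul_pow, norm_inv,
      norm_norm]
    have h3 : ‖A‖⁻¹ ^ 2 * ‖A x‖ ^ 2 ≤ ‖A‖⁻¹ * ⟪A x, x⟫ := by
      calc _ ≤ ‖A‖⁻¹ ^ 2 * (‖A‖ * ⟪A x, x⟫) := by gcongr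
        _ = _ := by field_simp
    have h4 : 0 ≤ ‖A‖⁻¹ * ⟪A x, x⟫ := by positivity
    linarith
  obtain ⟨c, hc1, hc2, hc3⟩ := exists_sq_eq_one_sub b hb1
  have hcomm : ∀ C, Commute C A → Commute C c := by
    intro C hC
    have hS : c ∈ (Set.centralizer {C} : Set (E →L[ℝ] E)) := by
      refine closure_minimal ?_ (Set.isClosed_centralizer _) hc3
      have : Algebra.adjoin ℝ {b} ≤ Subalgebra.centralizer ℝ {C} := by
        refine Algebra.adjoin_le ?_
        rintro _ rfl
        simp only [SetLike.mem_coe, Subalgebra.mem_centralizer_iff, Set.mem_singleton_iff,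
          forall_eq]
        exact (Commute.one_right C).sub_right (hC.smul_right _)
      exact this
    exact (Set.mem_centralizer_iff.1 hS C rfl)
  have hcsa : IsSelfAdjoint c := by
    have hbsa : IsSelfAdjoint b := .sub (.one _) (.smul (.all _) hA.isSelfAdjoint)
    have hcl : IsClosed {x : E →L[ℝ] E | IsSelfAdjoint x} :=
      isClosed_eq continuous_star continuous_id
    refine closure_minimal ?_ hcl hc3
    intro x hx
    induction hx using Algebra.adjoin_induction with
    | mem x hx => rw [Set.mem_singleton_iff.1 hx]; exact hbsa
    | algebraMap r => rw [Algebra.algebraMap_eq_smul_one]; exact .smul (.all _) (.one _)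
    | add x y _ _ hx hy => exact hx.add hy
    | mul x y hx' hy' hx hy =>
      exact (hx.commute_iff hy).1 (Algebra.commute_of_mem_adjoin_singleton_of_commute hy'
        (Algebra.commute_of_mem_adjoin_self hx').symm)
  have hcpos : (1 - c).IsPositive := by
    rw [isPositive_def']
    refine ⟨.sub (.one _) hcsa, fun x => ?_⟩
    rw [reApplyInnerSelf_apply]
    simp only [sub_apply, one_apply_eq_self, inner_sub_left, real_inner_self_eq_norm_sq,
      RCLike.re_to_real]
    have h1 := real_inner_le_norm (c x) x
    have h2 := c.le_of_opNorm_le hc1 x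
    nlinarith [norm_nonneg x]
  refine ⟨Real.sqrt ‖A‖ • (1 - c), hcpos.smul_of_nonneg (Real.sqrt_nonneg _), ?_, ?_⟩
  · rw [smul_mul_smul_comm, hc2, Real.mul_self_sqrt hpos.le, hb, sub_sub_cancel, smul_smul,
      mul_inv_cancel₀ hpos.ne', one_smul]
  · intro C hC
    exact ((Commute.one_right C).sub_right (hcomm C hC)).smul_right _

theorem IsPositive.eq_of_sq_eq_of_commute {P Q : E →L[ℝ] E} (hP : P.IsPositive)
    (hQ : Q.IsPositive) (h : P * P = Q * Q) (hc : Commute Q P) : P = Q := by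
  have hD : (P + Q) * (P - Q) = 0 := by
    rw [mul_sub, add_mul, add_mul, h, hc.eq]; abel
  ext x
  have h0 : P ((P - Q) x) + Q ((P - Q) x) = 0 := by
    simpa using congr($hD x)
  have h1 := hP.inner_nonneg_left ((P - Q) x)
  have h2 := hQ.inner_nonneg_left ((P - Q) x)
  have h3 : ⟪P ((P - Q) x), (P - Q) x⟫ + ⟪Q ((P - Q) x), (P - Q) x⟫ = 0 := by
    rw [← inner_add_left, h0, inner_zero_left]
  have h4 := hP.apply_eq_zero_of_inner (x := (P - Q) x) (by linarith)
  have h5 := hQ.apply_eq_zero_of_inner (x := (P - Q) x) (by linarith)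
  have h6 : ⟪(P - Q) x, (P - Q) x⟫ = 0 := by
    rw [(hP.isSelfAdjoint.sub hQ.isSelfAdjoint).isSymmetric.apply_clm, sub_apply, h4, h5]
    simp
  rw [inner_self_eq_zero, sub_apply, sub_eq_zero] at h6
  exact h6

theorem IsPositive.eq_of_sq_eq {P Q : E →L[ℝ] E} (hP : P.IsPositive) (hQ : Q.IsPositive)
    (h : P * P = Q * Q) : P = Q := by
  have hA : (P * P).IsPositive := by
    simpa [hP.isSelfAdjoint.adjoint_eq, mul_def] using isPositive_adjoint_comp_self P
  obtain ⟨S, hS, hSS, hSc⟩ := hA.exists_sqrt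
  rw [hP.eq_of_sq_eq_of_commute hS hSS.symm (hSc _ (((Commute.refl P).mul_right (.refl P)))).symm,
    hQ.eq_of_sq_eq_of_commute hS (hSS.trans h).symm
      (hSc _ (h ▸ ((Commute.refl Q).mul_right (.refl Q)))).symm]

end ContinuousLinearMap

theorem tsum_eq_of_tsum_ofReal_eq {ι κ : Type*} {f : ι → ℝ} {g : κ → ℝ} (hf : ∀ i, 0 ≤ f i)
    (hg : ∀ j, 0 ≤ g j) (h : ∑' i, ENNReal.ofReal (f i) = ∑' j, ENNReal.ofReal (g j)) :
    ∑' i, f i = ∑' j, g j := by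
  have h1 := congr_arg ENNReal.toReal h
  rw [ENNReal.tsum_toReal_eq (fun _ => ENNReal.ofReal_ne_top),
    ENNReal.tsum_toReal_eq (fun _ => ENNReal.ofReal_ne_top)] at h1
  simpa only [ENNReal.toReal_ofReal (hf _), ENNReal.toReal_ofReal (hg _)] using h1

theorem tsum_norm_sq_apply_eq_adjoint {ι κ : Type*} (e : HilbertBasis ι ℝ E)
    (f : HilbertBasis κ ℝ F) (A : E →L[ℝ] F) :
    ∑' i, ‖A (e i)‖ ^ 2 = ∑' j, ‖A.adjoint (f j)‖ ^ 2 := by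
  refine tsum_eq_of_tsum_ofReal_eq (fun _ => sq_nonneg _) (fun _ => sq_nonneg _) ?_
  simp_rw [ofReal_norm_sq_eq_tsum_inner_sq f, ofReal_norm_sq_eq_tsum_inner_sq e]
  rw [ENNReal.tsum_comm]
  simp_rw [ContinuousLinearMap.adjoint_inner_left, real_inner_comm]

/-- The trace of `A†A` equals the trace of `AA†`. -/
theorem tsum_inner_adjoint_comp_self {ι κ : Type*} (e : HilbertBasis ι ℝ E)
    (f : HilbertBasis κ ℝ F) (A : E →L[ℝ] F) :
    ∑' i, ⟪e i, (A.adjoint ∘L A) (e i)⟫ = ∑' j, ⟪f j, (A ∘L A.adjoint) (f j)⟫ := by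
  have h := tsum_norm_sq_apply_eq_adjoint e f A
  have h1 : ∀ x, ⟪x, A.adjoint (A x)⟫ = ‖A x‖ ^ 2 := fun x => by
    rw [ContinuousLinearMap.adjoint_inner_right, real_inner_self_eq_norm_sq]
  have h2 : ∀ y, ⟪y, A (A.adjoint y)⟫ = ‖A.adjoint y‖ ^ 2 := fun y => by
    rw [← ContinuousLinearMap.adjoint_inner_left, real_inner_self_eq_norm_sq]
  simpa only [ContinuousLinearMap.comp_apply, h1, h2] using h

theorem exists_comp_eq_of_norm_eq (p : E →L[ℝ] E) (hp : IsSelfAdjoint p) (A : E →L[ℝ] F)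
    (h : ∀ x, ‖A x‖ = ‖p (p x)‖) :
    ∃ Z : E →L[ℝ] F, Z ∘L p = A ∧ Z.adjoint ∘L Z = p ∘L p := by
  set W := (LinearMap.range p.toLinearMap).topologicalClosure with hW
  have : CompleteSpace W := (Submodule.isClosed_topologicalClosure _).completeSpace_coe
  have hmem : ∀ x, p x ∈ W := fun x => subset_closure ⟨x, rfl⟩
  set e : E →ₗ[ℝ] W := p.toLinearMap.codRestrict W hmem with he
  have hdense : DenseRange e := by
    intro w
    rw [closure_subtype, ← Set.range_comp]
    exact w.2
  have hbound : ∀ x, ‖A.toLinearMap x‖ ≤ ‖p‖ * ‖e x‖ := fun x =>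
    (h x).trans_le (p.le_opNorm (p x))
  set g : W →L[ℝ] F := A.toLinearMap.extendOfNorm e with hg
  have hge : ∀ x, g (e x) = A x := fun x => LinearMap.extendOfNorm_eq hdense ⟨_, hbound⟩ x
  have hgn : ∀ w : W, ‖g w‖ = ‖p w‖ := by
    intro w
    refine hdense.induction_on w (isClosed_eq (by fun_prop) (by fun_prop)) fun x => ?_
    rw [hge, h]
    rfl
  have hproj : ∀ x, p (W.orthogonalProjectionOnto x) = p x := by
    intro x
    have h1 : p (x - W.orthogonalProjectionOnto x) = 0 := by
      refine ext_inner_right ℝ fun y => ?_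
      rw [hp.isSymmetric.apply_clm, inner_zero_left]
      exact W.starProjection_inner_eq_zero x _ (hmem y)
    rw [map_sub, sub_eq_zero] at h1
    exact h1.symm
  refine ⟨g ∘L W.orthogonalProjectionOnto, ?_, ?_⟩
  · ext x
    have : W.orthogonalProjectionOnto (p x) = e x :=
      Submodule.orthogonalProjectionOnto_mem_subspace_eq_self (e x)
    rw [ContinuousLinearMap.comp_apply, ContinuousLinearMap.comp_apply, this, hge]
  · set Z := g ∘L W.orthogonalProjectionOnto with hZ
    have hZn : ∀ x, ‖Z x‖ = ‖p x‖ := fun x => (hgn _).trans (congr_arg norm (hproj x))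
    have hpp : (p ∘L p) = p.adjoint ∘L p := by rw [hp.adjoint_eq]
    rw [hpp, ← sub_eq_zero, ← ContinuousLinearMap.coe_inj]
    have hsymm : (Z.adjoint ∘L Z - p.adjoint ∘L p).toLinearMap.IsSymmetric :=
      ((ContinuousLinearMap.isPositive_adjoint_comp_self Z).isSelfAdjoint.sub
        (ContinuousLinearMap.isPositive_adjoint_comp_self p).isSelfAdjoint).isSymmetric
    refine hsymm.inner_map_self_eq_zero.1 fun x => ?_
    simp [inner_sub_left, ContinuousLinearMap.adjoint_inner_left, hZn]

/-- The trace of `|A|` equals the trace of `|A†|`. -/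
theorem tsum_inner_abs_eq_abs_adjoint {ι κ : Type*} (e : HilbertBasis ι ℝ E)
    (f : HilbertBasis κ ℝ F) {A : E →L[ℝ] F} {P : E →L[ℝ] E} {Q : F →L[ℝ] F}
    (hP : P.IsPositive) (hQ : Q.IsPositive) (hPA : P ∘L P = A.adjoint ∘L A)
    (hQA : Q ∘L Q = A ∘L A.adjoint) :
    ∑' i, ⟪e i, P (e i)⟫ = ∑' j, ⟪f j, Q (f j)⟫ := by
  obtain ⟨p, hp, hpP, -⟩ := hP.exists_sqrt
  have hn : ∀ x, ‖A x‖ = ‖p (p x)‖ := by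
    intro x
    have h1 : p (p x) = P x := congr($hpP x)
    rw [h1, ← sq_eq_sq₀ (norm_nonneg _) (norm_nonneg _), ← real_inner_self_eq_norm_sq,
      ← real_inner_self_eq_norm_sq, ← ContinuousLinearMap.adjoint_inner_left,
      ← hP.inner_left_eq_inner_right]
    exact congr(⟪$hPA x, x⟫).symm
  obtain ⟨Z, hZA, hZP⟩ := exists_comp_eq_of_norm_eq p hp.isSelfAdjoint A hn
  have hZQ : Z ∘L Z.adjoint = Q := by
    refine (ContinuousLinearMap.isPositive_self_comp_adjoint Z).eq_of_sq_eq hQ ?_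
    have hA' : A.adjoint = p ∘L Z.adjoint := by
      rw [← hZA, ContinuousLinearMap.adjoint_comp, hp.isSelfAdjoint.adjoint_eq]
    calc (Z ∘L Z.adjoint) ∘L (Z ∘L Z.adjoint) = Z ∘L (Z.adjoint ∘L Z) ∘L Z.adjoint := rfl
      _ = (Z ∘L p) ∘L (p ∘L Z.adjoint) := by rw [hZP]; rfl
      _ = Q ∘L Q := by rw [hZA, ← hA', hQA]
  rw [← hZQ, show P = Z.adjoint ∘L Z by rw [hZP]; exact hpP.symm]
  exact tsum_inner_adjoint_comp_self e f Z

/-- `tr[(C₁^{1/2} C₂ C₁^{1/2})^{1/2}] = tr[(R†R)^{1/2}]` where `Cᵢ = Sᵢ Sᵢ†` and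
`R = S₁† S₂`. -/
theorem tsum_inner_fidelity_eq {G : Type*} [NormedAddCommGroup G] [InnerProductSpace ℝ G]
    [CompleteSpace G] {ι κ : Type*} (e : HilbertBasis ι ℝ G) (f : HilbertBasis κ ℝ F)
    (S1 : E →L[ℝ] G) (S2 : F →L[ℝ] G) {q M : G →L[ℝ] G} {P : F →L[ℝ] F}
    (hq : q.IsPositive) (hqC : q ∘L q = S1 ∘L S1.adjoint) (hM : M.IsPositive)
    (hMC : M ∘L M = q ∘L (S2 ∘L S2.adjoint) ∘L q) (hP : P.IsPositive)
    (hPR : P ∘L P = (S1.adjoint ∘L S2).adjoint ∘L (S1.adjoint ∘L S2)) :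
    ∑' i, ⟪e i, M (e i)⟫ = ∑' j, ⟪f j, P (f j)⟫ := by
  refine (tsum_inner_abs_eq_abs_adjoint f e (A := q ∘L S2) hP hM ?_ ?_).symm
  · rw [hPR]
    simp only [ContinuousLinearMap.adjoint_comp, ContinuousLinearMap.adjoint_adjoint,
      hq.isSelfAdjoint.adjoint_eq]
    calc _ = S2.adjoint ∘L (S1 ∘L S1.adjoint) ∘L S2 := rfl
      _ = _ := by rw [← hqC]; rfl
  · rw [hMC]
    simp only [ContinuousLinearMap.adjoint_comp, hq.isSelfAdjoint.adjoint_eq]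
    rfl

end PositiveOperators

section BoundedDifferences

variable {T : Type*} [MeasurableSpace T] {ν : Measure T} [IsProbabilityMeasure ν]

theorem integral_pi_fin_succ {n : ℕ} {f : (Fin (n + 1) → T) → ℝ}
    (hf : Integrable f (Measure.pi fun _ => ν)) :
    ∫ x, f x ∂(Measure.pi fun _ => ν) =
      ∫ x, ∫ y, f (Fin.cons x y) ∂(Measure.pi fun _ : Fin n => ν) ∂ν := by
  have h := (measurePreserving_piFinSuccAbove (fun _ : Fin (n + 1) => ν) 0).symm
  have hi : Integrable (fun p => f ((MeasurableEquiv.piFinSuccAbove (fun _ => T) 0).symm p))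
      (ν.prod (Measure.pi fun _ : Fin n => ν)) :=
    (h.integrable_comp_emb (MeasurableEquiv.measurableEmbedding _)).2 hf
  rw [← h.integral_comp' f, integral_prod _ hi]
  simp [MeasurableEquiv.piFinSuccAbove_symm_apply, Fin.consEquiv]

theorem measurable_fin_cons {n : ℕ} :
    Measurable fun p : T × (Fin n → T) => (Fin.cons p.1 p.2 : Fin (n + 1) → T) := by
  rw [measurable_pi_iff]
  intro i
  refine Fin.cases ?_ (fun j => ?_) i
  · simpa using measurable_fst
  · simpa using (show Measurable fun p : T × (Fin n → T) => p.2 j by fun_prop)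

theorem integrable_of_abs_le {α : Type*} [MeasurableSpace α] {μ : Measure α} [IsFiniteMeasure μ]
    {f : α → ℝ} {M : ℝ} (hf : Measurable f) (hM : ∀ x, |f x| ≤ M) : Integrable f μ :=
  .of_bound hf.aestronglyMeasurable M (Filter.Eventually.of_forall hM)

theorem abs_integral_le_of_abs_le {α : Type*} [MeasurableSpace α] {μ : Measure α}
    [IsProbabilityMeasure μ] {f : α → ℝ} {M : ℝ} (hM : ∀ x, |f x| ≤ M) :
    |∫ x, f x ∂μ| ≤ M := by
  simpa using norm_integral_le_of_norm_le_const (μ := μ) (f := f)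
    (Filter.Eventually.of_forall hM)

theorem abs_exp_mul_sub_le {t r s M : ℝ} (hr : |r| ≤ M) (hs : |s| ≤ M) :
    |Real.exp (t * (r - s))| ≤ Real.exp (|t| * (M + M)) := by
  rw [Real.abs_exp, Real.exp_le_exp]
  refine (le_abs_self _).trans ?_
  rw [abs_mul]
  gcongr
  exact (abs_sub _ _).trans (add_le_add hr hs)

theorem integral_exp_le_of_abs_sub_le {g : T → ℝ} {M c : ℝ} (hg : Measurable g)
    (hM : ∀ x, |g x| ≤ M) (hd : ∀ x y, |g x - g y| ≤ c) (t : ℝ) :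
    ∫ x, Real.exp (t * (g x - ∫ y, g y ∂ν)) ∂ν ≤ Real.exp (c ^ 2 * t ^ 2 / 8) := by
  have : Nonempty T := nonempty_of_isProbabilityMeasure ν
  have hbdd : BddBelow (Set.range g) := ⟨-M, by
    rintro _ ⟨x, rfl⟩
    exact (abs_le.1 (hM x)).1⟩
  set a := ⨅ x, g x
  have hmem : ∀ x, g x ∈ Set.Icc a (a + c) := fun x => by
    refine ⟨ciInf_le hbdd x, ?_⟩
    have : g x - c ≤ a := le_ciInf fun y => by linarith [(abs_le.1 (hd x y)).2]
    linarith
  have h := (ProbabilityTheory.hasSubgaussianMGF_of_mem_Icc (μ := ν) hg.aemeasurable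
    (Filter.Eventually.of_forall hmem)).mgf_le t
  refine h.trans (Real.exp_le_exp.2 (le_of_eq ?_))
  simp only [add_sub_cancel_left, NNReal.coe_pow, NNReal.coe_div, coe_nnnorm, Real.norm_eq_abs,
    NNReal.coe_ofNat, div_pow, sq_abs]
  ring

theorem integral_exp_le_of_bounded_differences (c t : ℝ) :
    ∀ {n : ℕ} {f : (Fin n → T) → ℝ} {M : ℝ}, Measurable f → (∀ x, |f x| ≤ M) →
      (∀ i x y, (∀ j, j ≠ i → x j = y j) → |f x - f y| ≤ c) →
      ∫ x, Real.exp (t * (f x - ∫ y, f y ∂(Measure.pi fun _ => ν))) ∂(Measure.pi fun _ => ν) ≤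
        Real.exp (n * (c ^ 2 * t ^ 2 / 8)) := by
  intro n
  induction n with
  | zero =>
    intro f M _ _ _
    have : ∀ x, f x = f default := fun x => congr_arg f (Subsingleton.elim _ _)
    simp [this]
  | succ n ih =>
    intro f M hf hM hd
    set π := Measure.pi fun _ : Fin n => ν with hπ
    set g : T → ℝ := fun x => ∫ y, f (Fin.cons x y) ∂π with hg
    have hfm : Measurable fun p : T × (Fin n → T) => f (Fin.cons p.1 p.2) :=
      hf.comp measurable_fin_cons
    have hfx : ∀ x, Measurable fun y : Fin n → T => f (Fin.cons x y) := fun x =>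
      hfm.comp measurable_prodMk_left
    have hfi : ∀ x, Integrable (fun y : Fin n → T => f (Fin.cons x y)) π := fun x =>
      integrable_of_abs_le (hfx x) fun y => hM _
    have hgm : Measurable g := hfm.stronglyMeasurable.integral_prod_right.measurable
    have hgM : ∀ x, |g x| ≤ M := fun x => abs_integral_le_of_abs_le fun y => hM _
    have hgd : ∀ x y, |g x - g y| ≤ c := by
      intro x y
      rw [hg, ← integral_sub (hfi x) (hfi y)]
      refine abs_integral_le_of_abs_le fun z => hd 0 _ _ fun j hj => ?_
      obtain ⟨k, rfl⟩ := Fin.exists_succ_eq.2 hj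
      simp
    have hEf : ∫ x, f x ∂(Measure.pi fun _ => ν) = ∫ x, g x ∂ν :=
      integral_pi_fin_succ (integrable_of_abs_le hf hM)
    rw [hEf]
    set e := ∫ x, g x ∂ν
    have heM : |e| ≤ M := abs_integral_le_of_abs_le hgM
    rw [integral_pi_fin_succ (integrable_of_abs_le (by fun_prop)
      fun x => abs_exp_mul_sub_le (hM x) heM)]
    have hinner : ∀ x, ∫ y, Real.exp (t * (f (Fin.cons x y) - e)) ∂π ≤
        Real.exp (t * (g x - e)) * Real.exp (n * (c ^ 2 * t ^ 2 / 8)) := by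
      intro x
      have h1 : ∀ y, Real.exp (t * (f (Fin.cons x y) - e)) =
          Real.exp (t * (g x - e)) * Real.exp (t * (f (Fin.cons x y) - g x)) := fun y => by
        rw [← Real.exp_add]; congr 1; ring
      simp_rw [h1]
      rw [integral_const_mul]
      gcongr
      refine ih (hfx x) (fun y => hM _) fun i y z hyz => hd i.succ _ _ fun j => ?_
      refine Fin.cases (by simp) (fun k hk => ?_) j
      simpa using hyz k fun h => hk (by rw [h])
    calc _ ≤ ∫ x, Real.exp (t * (g x - e)) * Real.exp (n * (c ^ 2 * t ^ 2 / 8)) ∂ν := by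
          refine integral_mono_of_nonneg
            (Filter.Eventually.of_forall fun x => integral_nonneg fun y => (Real.exp_pos _).le)
            ?_ (Filter.Eventually.of_forall hinner)
          exact (integrable_of_abs_le (by fun_prop)
            fun x => abs_exp_mul_sub_le (hgM x) heM).mul_const _
      _ = (∫ x, Real.exp (t * (g x - e)) ∂ν) * Real.exp (n * (c ^ 2 * t ^ 2 / 8)) :=
          integral_mul_const _ _
      _ ≤ Real.exp (c ^ 2 * t ^ 2 / 8) * Real.exp (n * (c ^ 2 * t ^ 2 / 8)) := by
          gcongr
          exact integral_exp_le_of_abs_sub_le hgm hgM hgd t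
      _ = _ := by
          rw [← Real.exp_add]; congr 1; push_cast; ring

/-- McDiarmid's inequality, one-sided, with equal difference bounds. -/
theorem measureReal_ge_le_of_bounded_differences {n : ℕ} (hn : 0 < n) {f : (Fin n → T) → ℝ}
    {M c : ℝ} (hf : Measurable f) (hM : ∀ x, |f x| ≤ M) (hc : 0 < c)
    (hd : ∀ i x y, (∀ j, j ≠ i → x j = y j) → |f x - f y| ≤ c) {s : ℝ} (hs : 0 ≤ s) :
    (Measure.pi fun _ => ν).real {x | s ≤ f x - ∫ y, f y ∂(Measure.pi fun _ => ν)} ≤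
      Real.exp (-(2 * s ^ 2 / (n * c ^ 2))) := by
  set e := ∫ y, f y ∂(Measure.pi fun _ => ν)
  have heM : |e| ≤ M := abs_integral_le_of_abs_le hM
  have hn' : (0 : ℝ) < n := by exact_mod_cast hn
  set t : ℝ := 4 * s / (n * c ^ 2) with ht
  have h := ProbabilityTheory.measure_ge_le_exp_mul_mgf (μ := Measure.pi fun _ : Fin n => ν)
    (X := fun x => f x - e) (t := t) s (by positivity)
    (integrable_of_abs_le (by fun_prop) fun x => abs_exp_mul_sub_le (hM x) heM)
  refine h.trans ?_
  have h2 := integral_exp_le_of_bounded_differences (ν := ν) c t hf hM hd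
  calc _ ≤ Real.exp (-t * s) * Real.exp (n * (c ^ 2 * t ^ 2 / 8)) := by
        gcongr
        exact h2
    _ = _ := by
        rw [← Real.exp_add, ht]
        congr 1
        field_simp
        ring

/-- McDiarmid's inequality, two-sided, with equal difference bounds. -/
theorem measureReal_abs_ge_le_of_bounded_differences {n : ℕ} (hn : 0 < n) {f : (Fin n → T) → ℝ}
    {M c : ℝ} (hf : Measurable f) (hM : ∀ x, |f x| ≤ M) (hc : 0 < c)
    (hd : ∀ i x y, (∀ j, j ≠ i → x j = y j) → |f x - f y| ≤ c) {s : ℝ} (hs : 0 ≤ s) :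
    (Measure.pi fun _ => ν).real {x | s ≤ |f x - ∫ y, f y ∂(Measure.pi fun _ => ν)|} ≤
      2 * Real.exp (-(2 * s ^ 2 / (n * c ^ 2))) := by
  have h1 := measureReal_ge_le_of_bounded_differences (ν := ν) hn hf hM hc hd hs
  have h2 := measureReal_ge_le_of_bounded_differences (ν := ν) (f := fun x => -f x) hn hf.neg
    (by simpa using hM) hc (fun i x y h => by
      rw [neg_sub_neg, abs_sub_comm]; exact hd i x y h) hs
  have hsub : {x | s ≤ |f x - ∫ y, f y ∂(Measure.pi fun _ => ν)|} ⊆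
      {x | s ≤ f x - ∫ y, f y ∂(Measure.pi fun _ => ν)} ∪
        {x | s ≤ -f x - ∫ y, -f y ∂(Measure.pi fun _ => ν)} := by
    intro x hx
    rcases le_abs.1 (show s ≤ _ from hx) with h | h
    · exact Or.inl h
    · refine Or.inr ?_
      change s ≤ -f x - ∫ y, -f y ∂(Measure.pi fun _ => ν)
      rw [integral_neg]
      linarith
  refine (measureReal_mono hsub).trans ((measureReal_union_le _ _).trans ?_)
  linarith

end BoundedDifferences

theorem integral_inner_const {T : Type*} [MeasurableSpace T] {ν : Measure T}
    {V : Type*} [NormedAddCommGroup V] [InnerProductSpace ℝ V] [CompleteSpace V]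
    {f : T → V} (hf : Integrable f ν) (c : V) :
    ∫ x, ⟪f x, c⟫ ∂ν = ⟪∫ x, f x ∂ν, c⟫ := by
  rw [real_inner_comm, ← integral_inner hf]
  exact integral_congr_ae (.of_forall fun x => real_inner_comm _ _)

section Deviation

variable {T : Type*} [MeasurableSpace T] {ν : Measure T} [IsProbabilityMeasure ν]
  {V : Type*} [NormedAddCommGroup V] [InnerProductSpace ℝ V] [CompleteSpace V]

theorem integral_norm_sub_integral_sq_le {ζ : T → V} {b : ℝ} (hζ : StronglyMeasurable ζ)
    (hb : ∀ x, ‖ζ x‖ ≤ b) : ∫ x, ‖ζ x - ∫ y, ζ y ∂ν‖ ^ 2 ∂ν ≤ b ^ 2 := by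
  have hi : Integrable ζ ν := .of_bound hζ.aestronglyMeasurable b (.of_forall hb)
  set μ := ∫ y, ζ y ∂ν with hμ
  have hi2 : Integrable (fun x => ‖ζ x‖ ^ 2) ν :=
    integrable_of_abs_le (M := b ^ 2) (hζ.norm.measurable.pow_const 2) fun x => by
      rw [abs_of_nonneg (by positivity)]
      exact pow_le_pow_left₀ (norm_nonneg _) (hb x) 2
  have hi3 : Integrable (fun x => 2 * ⟪ζ x, μ⟫) ν := (hi.inner_const μ).const_mul 2
  have h1 : ∫ x, ‖ζ x - μ‖ ^ 2 ∂ν = ∫ x, ‖ζ x‖ ^ 2 ∂ν - ‖μ‖ ^ 2 := by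
    simp_rw [norm_sub_sq_real]
    rw [integral_add (hi2.sub' hi3) (integrable_const _), integral_sub hi2 hi3,
      integral_const_mul, integral_inner_const hi, ← hμ, real_inner_self_eq_norm_sq]
    simp
    ring
  have h2 : ∫ x, ‖ζ x‖ ^ 2 ∂ν ≤ b ^ 2 := by
    calc _ ≤ ∫ _, b ^ 2 ∂ν := integral_mono hi2 (integrable_const _) fun x =>
          pow_le_pow_left₀ (norm_nonneg _) (hb x) 2
      _ = _ := by simp
  rw [h1]
  nlinarith [sq_nonneg ‖μ‖]

theorem integral_norm_sum_sq_le {g : T → V} {M v : ℝ} (hg : StronglyMeasurable g)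
    (hM : ∀ x, ‖g x‖ ≤ M) (hg0 : ∫ x, g x ∂ν = 0) (hv : ∫ x, ‖g x‖ ^ 2 ∂ν ≤ v) :
    ∀ n : ℕ, ∫ x, ‖∑ k, g (x k)‖ ^ 2 ∂(Measure.pi fun _ : Fin n => ν) ≤ n * v := by
  have hgi : Integrable g ν := .of_bound hg.aestronglyMeasurable M (.of_forall hM)
  have hSm : ∀ n : ℕ, StronglyMeasurable fun x : Fin n → T => ∑ k, g (x k) := fun n =>
    Finset.stronglyMeasurable_fun_sum _ fun k _ => hg.comp_measurable (measurable_pi_apply k)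
  have hSb : ∀ (n : ℕ) (x : Fin n → T), ‖∑ k, g (x k)‖ ≤ n * M := fun n x => by
    refine (norm_sum_le _ _).trans ((Finset.sum_le_sum fun k _ => hM (x k)).trans ?_)
    simp
  have hS2 : ∀ n : ℕ, Integrable (fun x : Fin n → T => ‖∑ k, g (x k)‖ ^ 2)
      (Measure.pi fun _ : Fin n => ν) := fun n =>
    integrable_of_abs_le (M := (n * M) ^ 2) ((hSm n).norm.measurable.pow_const 2) fun x => by
      rw [abs_of_nonneg (by positivity)]
      exact pow_le_pow_left₀ (norm_nonneg _) (hSb n x) 2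
  intro n
  induction n with
  | zero => simp
  | succ n ih =>
    have hSi : Integrable (fun x : Fin n → T => ∑ k, g (x k)) (Measure.pi fun _ : Fin n => ν) :=
      .of_bound (hSm n).aestronglyMeasurable _ (.of_forall (hSb n))
    have hg2 : Integrable (fun x => ‖g x‖ ^ 2) ν :=
      integrable_of_abs_le (M := M ^ 2) (hg.norm.measurable.pow_const 2) fun x => by
        rw [abs_of_nonneg (by positivity)]
        exact pow_le_pow_left₀ (norm_nonneg _) (hM x) 2
    rw [integral_pi_fin_succ (hS2 (n + 1))]
    simp_rw [Fin.sum_univ_succ, Fin.cons_zero, Fin.cons_succ, norm_add_sq_real]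
    set w := ∫ y, ∑ k, g (y k) ∂(Measure.pi fun _ : Fin n => ν)
    have hinner : ∀ x, ∫ y, (‖g x‖ ^ 2 + 2 * ⟪g x, ∑ k, g (y k)⟫ + ‖∑ k, g (y k)‖ ^ 2)
        ∂(Measure.pi fun _ : Fin n => ν) = ‖g x‖ ^ 2 + 2 * ⟪g x, w⟫ +
          ∫ y, ‖∑ k, g (y k)‖ ^ 2 ∂(Measure.pi fun _ : Fin n => ν) := by
      intro x
      have hI : Integrable (fun y : Fin n → T => 2 * ⟪g x, ∑ k, g (y k)⟫)
          (Measure.pi fun _ : Fin n => ν) := (hSi.const_inner (g x)).const_mul 2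
      rw [integral_add ((integrable_const _).fun_add hI) (hS2 n),
        integral_add (integrable_const _) hI,
        integral_const_mul, integral_inner hSi]
      simp [w]
    simp_rw [hinner]
    have hI : Integrable (fun x => 2 * ⟪g x, w⟫) ν := (hgi.inner_const w).const_mul 2
    rw [integral_add (hg2.fun_add hI) (integrable_const _), integral_add hg2 hI, integral_const_mul,
      integral_inner_const hgi, hg0]
    simp only [inner_zero_left, mul_zero, add_zero, integral_const, probReal_univ, one_smul]
    push_cast
    linarith

theorem integral_norm_mean_sub_le {ζ : T → V} {b : ℝ} (hζ : StronglyMeasurable ζ)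
    (hb : ∀ x, ‖ζ x‖ ≤ b) {n : ℕ} (hn : 0 < n) :
    ∫ x, ‖(n : ℝ)⁻¹ • ∑ k, ζ (x k) - ∫ y, ζ y ∂ν‖ ∂(Measure.pi fun _ : Fin n => ν) ≤
      b / Real.sqrt n := by
  have hn' : (0 : ℝ) < n := by exact_mod_cast hn
  have : Nonempty T := nonempty_of_isProbabilityMeasure ν
  have hb0 : 0 ≤ b := (norm_nonneg _).trans (hb (Classical.arbitrary T))
  set μ := ∫ y, ζ y ∂ν with hμ
  have hi : Integrable ζ ν := .of_bound hζ.aestronglyMeasurable b (.of_forall hb)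
  set g : T → V := fun x => ζ x - μ with hg
  have hgm : StronglyMeasurable g := hζ.sub stronglyMeasurable_const
  have hgM : ∀ x, ‖g x‖ ≤ b + ‖μ‖ := fun x =>
    (norm_sub_le _ _).trans (add_le_add_left (hb x) _)
  have hg0 : ∫ x, g x ∂ν = 0 := by
    rw [hg, integral_sub hi (integrable_const _)]
    simp [hμ]
  have hv := integral_norm_sum_sq_le hgm hgM hg0 (integral_norm_sub_integral_sq_le hζ hb) n
  have heq : ∀ x : Fin n → T, ‖(n : ℝ)⁻¹ • ∑ k, ζ (x k) - μ‖ =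
      (n : ℝ)⁻¹ * ‖∑ k, g (x k)‖ := by
    intro x
    have : (n : ℝ)⁻¹ • ∑ k, ζ (x k) - μ = (n : ℝ)⁻¹ • ∑ k, g (x k) := by
      simp only [hg, Finset.sum_sub_distrib, Finset.sum_const, Finset.card_univ, Fintype.card_fin,
        smul_sub]
      rw [← Nat.cast_smul_eq_nsmul ℝ, smul_smul, inv_mul_cancel₀ hn'.ne', one_smul]
    rw [this, norm_smul, Real.norm_of_nonneg (by positivity)]
  simp_rw [heq]
  rw [integral_const_mul]
  have hSm : StronglyMeasurable fun x : Fin n → T => ∑ k, g (x k) :=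
    Finset.stronglyMeasurable_fun_sum _ fun k _ => hgm.comp_measurable (measurable_pi_apply k)
  set I := ∫ x, ‖∑ k, g (x k)‖ ∂(Measure.pi fun _ : Fin n => ν) with hI
  have hI0 : 0 ≤ I := integral_nonneg fun _ => norm_nonneg _
  have hSb : ∀ x : Fin n → T, ‖∑ k, g (x k)‖ ≤ n * (b + ‖μ‖) := fun x => by
    refine (norm_sum_le _ _).trans ((Finset.sum_le_sum fun k _ => hgM (x k)).trans ?_)
    simp [mul_add]
  have hI2 : I ^ 2 ≤ n * b ^ 2 := by
    have hi1 : Integrable (fun x : Fin n → T => ‖∑ k, g (x k)‖) (Measure.pi fun _ => ν) :=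
      integrable_of_abs_le hSm.norm.measurable fun x => by
        rw [abs_norm]; exact hSb x
    have hi2 : Integrable (fun x : Fin n → T => ‖∑ k, g (x k)‖ ^ 2) (Measure.pi fun _ => ν) :=
      integrable_of_abs_le (M := (n * (b + ‖μ‖)) ^ 2) (hSm.norm.measurable.pow_const 2)
        fun x => by
          rw [abs_of_nonneg (by positivity)]
          exact pow_le_pow_left₀ (norm_nonneg _) (hSb x) 2
    have h0 : 0 ≤ ∫ x, (‖∑ k, g (x k)‖ - I) ^ 2 ∂(Measure.pi fun _ : Fin n => ν) :=
      integral_nonneg fun _ => sq_nonneg _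
    simp_rw [sub_sq] at h0
    rw [integral_add (hi2.sub' ((hi1.const_mul 2).mul_const I)) (integrable_const _),
      integral_sub hi2 ((hi1.const_mul 2).mul_const I), integral_mul_const, integral_const_mul,
      ← hI] at h0
    simp only [integral_const, probReal_univ, one_smul] at h0
    nlinarith
  have hs : 0 < Real.sqrt n := Real.sqrt_pos.2 hn'
  have hsq : Real.sqrt n ^ 2 = n := Real.sq_sqrt hn'.le
  have hle : I ≤ Real.sqrt n * b := by
    refine le_of_sq_le_sq ?_ (by positivity)
    rwa [mul_pow, hsq]
  rw [le_div_iff₀ hs]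
  calc (n : ℝ)⁻¹ * I * Real.sqrt n ≤ (n : ℝ)⁻¹ * (Real.sqrt n * b) * Real.sqrt n := by gcongr
    _ = (n : ℝ)⁻¹ * Real.sqrt n ^ 2 * b := by ring
    _ = b := by rw [hsq, inv_mul_cancel₀ hn'.ne', one_mul]

end Deviation


theorem norm_inv_smul_sum_le {α G : Type*} [SeminormedAddCommGroup G] [NormedSpace ℝ G]
    {ζ : α → G} {b : ℝ}
    (hb : ∀ x, ‖ζ x‖ ≤ b) {m : ℕ}
    (hm : 0 < m) (X : Fin m → α) : ‖(m : ℝ)⁻¹ • ∑ j, ζ (X j)‖ ≤ b := by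
  have hm' : (0 : ℝ) < m := by exact_mod_cast hm
  rw [norm_smul, Real.norm_of_nonneg (by positivity), inv_mul_le_iff₀ hm']
  refine (norm_sum_le _ _).trans ((Finset.sum_le_sum fun j _ => hb (X j)).trans ?_)
  simp

theorem sum_sub_sum_eq_of_forall_ne {α G : Type*} [AddCommGroup G] {m : ℕ} (f : α → G)
    {i : Fin m} {x y : Fin m → α} (h : ∀ j, j ≠ i → x j = y j) :
    ∑ j, f (x j) - ∑ j, f (y j) = f (x i) - f (y i) := by
  rw [← Finset.sum_sub_distrib]
  refine Finset.sum_eq_single i (fun j _ hj => ?_) (by simp)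
  rw [h j hj, sub_self]

section Concentration

variable {T : Type*} [MeasurableSpace T] {ν : Measure T} [IsProbabilityMeasure ν]
  {V : Type*} [NormedAddCommGroup V] [InnerProductSpace ℝ V] [CompleteSpace V]

theorem abs_inv_smul_sum_sub_le {f : T → ℝ} {a : ℝ} (hf : Measurable f) (hf0 : ∀ x, 0 ≤ f x)
    (hfa : ∀ x, f x ≤ a) {m : ℕ} (hm : 0 < m) (X : Fin m → T) :
    |(m : ℝ)⁻¹ * ∑ j, f (X j) - ∫ x, f x ∂ν| ≤ a := by
  have hm' : (0 : ℝ) < m := by exact_mod_cast hm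
  have hi : Integrable f ν := integrable_of_abs_le (M := a) hf fun x => by
    rw [abs_of_nonneg (hf0 x)]; exact hfa x
  have h1 : 0 ≤ ∫ x, f x ∂ν := integral_nonneg hf0
  have h2 : ∫ x, f x ∂ν ≤ a := by
    calc _ ≤ ∫ _, a ∂ν := integral_mono hi (integrable_const _) hfa
      _ = a := by simp
  have h3 : 0 ≤ (m : ℝ)⁻¹ * ∑ j, f (X j) :=
    mul_nonneg (by positivity) (Finset.sum_nonneg fun j _ => hf0 _)
  have h4 : (m : ℝ)⁻¹ * ∑ j, f (X j) ≤ a := by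
    rw [inv_mul_le_iff₀ hm']
    refine (Finset.sum_le_sum fun j _ => hfa (X j)).trans ?_
    simp
  rw [abs_le]
  constructor <;> linarith

/-- A linear statistic minus twice a Lipschitz function of an empirical mean concentrates around
its population version. -/
theorem ofReal_one_sub_le_pi_abs_sub_le {f : T → ℝ} {ζ : T → V} {N : V → ℝ} {a b l : ℝ}
    (ha : 0 < a) (hl : 0 ≤ l) (hf : Measurable f) (hf0 : ∀ x, 0 ≤ f x) (hfa : ∀ x, f x ≤ a)
    (hζ : StronglyMeasurable ζ) (hb : ∀ x, ‖ζ x‖ ≤ b)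
    (hN : ∀ v w, |N v - N w| ≤ l * ‖v - w‖) {m : ℕ} (hm : 0 < m) {δ : ℝ} (hδ0 : 0 < δ)
    (hδ1 : δ < 1) :
    ENNReal.ofReal (1 - δ) ≤ (Measure.pi fun _ : Fin m => ν) {X |
      |((m : ℝ)⁻¹ * ∑ j, f (X j) - 2 * N ((m : ℝ)⁻¹ • ∑ j, ζ (X j))) -
        ((∫ x, f x ∂ν) - 2 * N (∫ x, ζ x ∂ν))| ≤
      a * (2 * Real.log (6 / δ) / m + Real.sqrt (2 * Real.log (6 / δ) / m)) +
        2 * Real.sqrt 2 * b * l *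
          Real.sqrt (2 * Real.log (6 / δ) / m + Real.sqrt (2 * Real.log (6 / δ) / m))} := by
  have hm' : (0 : ℝ) < m := by exact_mod_cast hm
  have : Nonempty T := nonempty_of_isProbabilityMeasure ν
  have hb0 : 0 ≤ b := (norm_nonneg _).trans (hb (Classical.arbitrary T))
  have hlog : 1 ≤ Real.log (6 / δ) := by
    rw [Real.le_log_iff_exp_le (by positivity), le_div_iff₀ hδ0]
    have := Real.exp_one_lt_three
    nlinarith [Real.exp_pos 1]
  set τ := 2 * Real.log (6 / δ) / m with hτ
  have hτ0 : 0 < τ := by positivity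
  set s := Real.sqrt τ with hs
  have hs0 : 0 < s := Real.sqrt_pos.2 hτ0
  have hs2 : s ^ 2 = τ := Real.sq_sqrt hτ0.le
  set r2 := Real.sqrt 2 with hr2
  have hr20 : 0 < r2 := Real.sqrt_pos.2 two_pos
  have hr22 : r2 ^ 2 = 2 := Real.sq_sqrt two_pos.le
  have hi : Integrable ζ ν := .of_bound hζ.aestronglyMeasurable b (.of_forall hb)
  have hζb : ‖∫ x, ζ x ∂ν‖ ≤ b := by
    simpa using norm_integral_le_of_norm_le_const (μ := ν) (.of_forall hb)
  have hlb : 0 ≤ l * b := by positivity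
  set F : (Fin m → T) → ℝ := fun X =>
    (m : ℝ)⁻¹ * ∑ j, f (X j) - 2 * N ((m : ℝ)⁻¹ • ∑ j, ζ (X j)) with hF
  rcases lt_or_ge 1 τ with h1 | h1
  · refine le_trans (ENNReal.ofReal_le_one.2 (by linarith)) (le_of_eq ?_)
    rw [← measure_univ (μ := Measure.pi fun _ : Fin m => ν)]
    congr 1
    refine (Set.eq_univ_of_forall fun X => ?_).symm
    have e1 := abs_inv_smul_sum_sub_le (ν := ν) hf hf0 hfa hm X
    have e2 := hN ((m : ℝ)⁻¹ • ∑ j, ζ (X j)) (∫ x, ζ x ∂ν)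
    have e3 : ‖(m : ℝ)⁻¹ • ∑ j, ζ (X j) - ∫ x, ζ x ∂ν‖ ≤ b + b :=
      (norm_sub_le _ _).trans (add_le_add (norm_inv_smul_sum_le hb hm X) hζb)
    have e4 : l * ‖(m : ℝ)⁻¹ • ∑ j, ζ (X j) - ∫ x, ζ x ∂ν‖ ≤ l * (b + b) := by gcongr
    have hs1 : 1 ≤ s := Real.one_le_sqrt.2 h1.le
    have e5 : r2 ≤ Real.sqrt (τ + s) := Real.sqrt_le_sqrt (by linarith)
    have e6 : r2 * r2 * (l * b) ≤ r2 * Real.sqrt (τ + s) * (l * b) := by gcongr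
    have e7 : a * 1 ≤ a * (τ + s) := by gcongr; linarith
    show |F X - _| ≤ _
    have e8 : F X - ((∫ x, f x ∂ν) - 2 * N (∫ x, ζ x ∂ν)) =
        ((m : ℝ)⁻¹ * ∑ j, f (X j) - ∫ x, f x ∂ν) -
          2 * (N ((m : ℝ)⁻¹ • ∑ j, ζ (X j)) - N (∫ x, ζ x ∂ν)) := by
      simp only [hF]; ring
    rw [e8]
    refine (abs_sub _ _).trans ?_
    rw [abs_mul, abs_two]
    nlinarith
  · have hNc : Continuous N := by
      refine LipschitzWith.continuous (K := ⟨l, hl⟩) (LipschitzWith.of_dist_le_mul fun v w => ?_)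
      rw [Real.dist_eq, dist_eq_norm]
      exact hN v w
    have hSm : StronglyMeasurable fun X : Fin m → T => (m : ℝ)⁻¹ • ∑ j, ζ (X j) :=
      (Finset.stronglyMeasurable_fun_sum _ fun k _ =>
        hζ.comp_measurable (measurable_pi_apply k)).const_smul _
    have hNm : StronglyMeasurable fun X : Fin m → T => N ((m : ℝ)⁻¹ • ∑ j, ζ (X j)) :=
      hNc.comp_stronglyMeasurable hSm
    have hfm : Measurable fun X : Fin m → T => (m : ℝ)⁻¹ * ∑ j, f (X j) :=
      (Finset.measurable_sum _ fun k _ => hf.comp (measurable_pi_apply k)).const_mul _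
    have hFm : Measurable F := hfm.sub (hNm.measurable.const_mul 2)
    have hfM : ∀ X : Fin m → T, |(m : ℝ)⁻¹ * ∑ j, f (X j)| ≤ a := fun X => by
      simpa using norm_inv_smul_sum_le (ζ := f) (b := a)
        (fun x => by rw [Real.norm_of_nonneg (hf0 x)]; exact hfa x) hm X
    have hNM : ∀ X : Fin m → T, |N ((m : ℝ)⁻¹ • ∑ j, ζ (X j))| ≤ l * b + |N 0| := fun X => by
      have h := hN ((m : ℝ)⁻¹ • ∑ j, ζ (X j)) 0
      rw [sub_zero] at h
      have h' : l * ‖(m : ℝ)⁻¹ • ∑ j, ζ (X j)‖ ≤ l * b := by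
        gcongr; exact norm_inv_smul_sum_le hb hm X
      have := abs_sub_abs_le_abs_sub (N ((m : ℝ)⁻¹ • ∑ j, ζ (X j))) (N 0)
      linarith
    have hFM : ∀ X, |F X| ≤ a + 2 * (l * b + |N 0|) := fun X => by
      refine (abs_sub _ _).trans ?_
      rw [abs_mul 2, abs_two]
      have := hfM X
      have := hNM X
      linarith
    set c := (a + 4 * (l * b)) / m with hc
    have hc0 : 0 < c := by positivity
    have hd : ∀ (i : Fin m) (x y : Fin m → T), (∀ j, j ≠ i → x j = y j) →
        |F x - F y| ≤ c := by
      intro i x y hxy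
      have e1 : (m : ℝ)⁻¹ * ∑ j, f (x j) - (m : ℝ)⁻¹ * ∑ j, f (y j) =
          (m : ℝ)⁻¹ * (f (x i) - f (y i)) := by
        rw [← mul_sub, sum_sub_sum_eq_of_forall_ne f hxy]
      have e2 : (m : ℝ)⁻¹ • ∑ j, ζ (x j) - (m : ℝ)⁻¹ • ∑ j, ζ (y j) =
          (m : ℝ)⁻¹ • (ζ (x i) - ζ (y i)) := by
        rw [← smul_sub, sum_sub_sum_eq_of_forall_ne ζ hxy]
      have e3 := hN ((m : ℝ)⁻¹ • ∑ j, ζ (x j)) ((m : ℝ)⁻¹ • ∑ j, ζ (y j))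
      rw [e2, norm_smul, Real.norm_of_nonneg (by positivity)] at e3
      have e4 : ‖ζ (x i) - ζ (y i)‖ ≤ b + b :=
        (norm_sub_le _ _).trans (add_le_add (hb _) (hb _))
      have e5 : l * ((m : ℝ)⁻¹ * ‖ζ (x i) - ζ (y i)‖) ≤ l * ((m : ℝ)⁻¹ * (b + b)) := by gcongr
      have e6 : |f (x i) - f (y i)| ≤ a := by
        rw [abs_le]
        have := hf0 (x i)
        have := hf0 (y i)
        have := hfa (x i)
        have := hfa (y i)
        constructor <;> linarith
      have e7 : F x - F y = (m : ℝ)⁻¹ * (f (x i) - f (y i)) -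
          2 * (N ((m : ℝ)⁻¹ • ∑ j, ζ (x j)) - N ((m : ℝ)⁻¹ • ∑ j, ζ (y j))) := by
        rw [← e1]; simp only [hF]; ring
      have e8 : (m : ℝ)⁻¹ * |f (x i) - f (y i)| ≤ (m : ℝ)⁻¹ * a := by gcongr
      rw [e7]
      refine (abs_sub _ _).trans ?_
      rw [abs_mul, abs_mul, abs_two, abs_of_pos (inv_pos.2 hm')]
      calc _ ≤ (m : ℝ)⁻¹ * a + 2 * (l * ((m : ℝ)⁻¹ * (b + b))) := by linarith
        _ = c := by rw [hc]; field_simp; ring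
    have htail := measureReal_abs_ge_le_of_bounded_differences (ν := ν) hm hFm hFM hc0 hd
      (s := (a + 4 * (l * b)) * s / 2) (by positivity)
    have hexp : 2 * Real.exp (-(2 * ((a + 4 * (l * b)) * s / 2) ^ 2 / (m * c ^ 2))) = δ / 3 := by
      have : 2 * ((a + 4 * (l * b)) * s / 2) ^ 2 / (m * c ^ 2) = Real.log (6 / δ) := by
        have hne : a + 4 * (l * b) ≠ 0 := by positivity
        rw [div_pow, mul_pow, hs2, hc, hτ]
        field_simp
      rw [this, Real.exp_neg, Real.exp_log (by positivity)]
      field_simp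
      norm_num
    rw [hexp] at htail
    set E := ∫ X, F X ∂(Measure.pi fun _ : Fin m => ν) with hE
    have hbias : |E - ((∫ x, f x ∂ν) - 2 * N (∫ x, ζ x ∂ν))| ≤ 2 * l * b * s / r2 := by
      have hfi : Integrable (fun X : Fin m → T => (m : ℝ)⁻¹ * ∑ j, f (X j))
          (Measure.pi fun _ => ν) := integrable_of_abs_le hfm hfM
      have hNi : Integrable (fun X : Fin m → T => N ((m : ℝ)⁻¹ • ∑ j, ζ (X j)))
          (Measure.pi fun _ => ν) := integrable_of_abs_le hNm.measurable hNM
      have hfi' : Integrable f ν := integrable_of_abs_le (M := a) hf fun x => by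
        rw [abs_of_nonneg (hf0 x)]; exact hfa x
      have e1 : ∫ X, (m : ℝ)⁻¹ * ∑ j, f (X j) ∂(Measure.pi fun _ : Fin m => ν) =
          ∫ x, f x ∂ν := by
        rw [integral_const_mul, integral_finsetSum _ fun j _ => integrable_comp_eval hfi']
        simp_rw [integral_comp_eval (μ := fun _ : Fin m => ν) hf.aestronglyMeasurable]
        simp [hm'.ne']
      have e2 : E = (∫ x, f x ∂ν) -
          2 * ∫ X, N ((m : ℝ)⁻¹ • ∑ j, ζ (X j)) ∂(Measure.pi fun _ : Fin m => ν) := by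
        rw [hE]
        simp only [hF]
        rw [integral_sub hfi (hNi.const_mul 2), e1, integral_const_mul]
      have e3 : |(∫ X, N ((m : ℝ)⁻¹ • ∑ j, ζ (X j)) ∂(Measure.pi fun _ : Fin m => ν)) -
          N (∫ x, ζ x ∂ν)| ≤ l * (b / Real.sqrt m) := by
        have e4 : (∫ X, N ((m : ℝ)⁻¹ • ∑ j, ζ (X j)) ∂(Measure.pi fun _ : Fin m => ν)) -
            N (∫ x, ζ x ∂ν) = ∫ X, (N ((m : ℝ)⁻¹ • ∑ j, ζ (X j)) - N (∫ x, ζ x ∂ν))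
              ∂(Measure.pi fun _ : Fin m => ν) := by
          rw [integral_sub hNi (integrable_const _)]
          simp
        have e5 : Integrable (fun X : Fin m → T =>
            ‖(m : ℝ)⁻¹ • ∑ j, ζ (X j) - ∫ x, ζ x ∂ν‖) (Measure.pi fun _ => ν) := by
          refine integrable_of_abs_le (M := b + b)
            (hSm.sub stronglyMeasurable_const).norm.measurable fun X => ?_
          rw [abs_norm]
          exact (norm_sub_le _ _).trans (add_le_add (norm_inv_smul_sum_le hb hm X) hζb)
        rw [e4]
        calc _ ≤ ∫ X, |N ((m : ℝ)⁻¹ • ∑ j, ζ (X j)) - N (∫ x, ζ x ∂ν)|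
              ∂(Measure.pi fun _ : Fin m => ν) := abs_integral_le_integral_abs
          _ ≤ ∫ X, l * ‖(m : ℝ)⁻¹ • ∑ j, ζ (X j) - ∫ x, ζ x ∂ν‖
              ∂(Measure.pi fun _ : Fin m => ν) :=
            integral_mono (hNi.sub' (integrable_const _)).abs (e5.const_mul l) fun X => hN _ _
          _ ≤ _ := by
            rw [integral_const_mul]
            gcongr
            exact integral_norm_mean_sub_le hζ hb hm
      have e6 : 1 / Real.sqrt m ≤ s / r2 := by
        rw [div_le_div_iff₀ (Real.sqrt_pos.2 hm') hr20, one_mul, hs, hr2,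
          ← Real.sqrt_mul hτ0.le]
        refine Real.sqrt_le_sqrt ?_
        rw [hτ, div_mul_cancel₀ _ hm'.ne']
        linarith
      have e7 : (∫ x, f x ∂ν) -
          2 * (∫ X, N ((m : ℝ)⁻¹ • ∑ j, ζ (X j)) ∂(Measure.pi fun _ : Fin m => ν)) -
            ((∫ x, f x ∂ν) - 2 * N (∫ x, ζ x ∂ν)) =
          -(2 * ((∫ X, N ((m : ℝ)⁻¹ • ∑ j, ζ (X j)) ∂(Measure.pi fun _ : Fin m => ν)) -
            N (∫ x, ζ x ∂ν))) := by ring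
      rw [e2, e7, abs_neg, abs_mul, abs_two]
      calc _ ≤ 2 * (l * (b / Real.sqrt m)) := by gcongr
        _ = 2 * (l * b) * (1 / Real.sqrt m) := by ring
        _ ≤ 2 * (l * b) * (s / r2) := by gcongr
        _ = _ := by ring
    set A := {X : Fin m → T | (a + 4 * (l * b)) * s / 2 ≤ |F X - E|} with hA
    have hAm : MeasurableSet A := measurableSet_le measurable_const
      (hFm.sub measurable_const).abs
    have hle : ENNReal.ofReal (1 - δ) ≤ (Measure.pi fun _ : Fin m => ν) Aᶜ := by
      rw [← ofReal_measureReal, probReal_compl_eq_one_sub hAm]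
      exact ENNReal.ofReal_le_ofReal (by linarith)
    refine hle.trans (measure_mono fun X hX => ?_)
    have hX' : |F X - E| < (a + 4 * (l * b)) * s / 2 := by
      simpa [hA] using hX
    show |F X - _| ≤ _
    have t1 := abs_sub_le (F X) E ((∫ x, f x ∂ν) - 2 * N (∫ x, ζ x ∂ν))
    have hs1 : s ≤ 1 := Real.sqrt_le_one.2 h1
    have t2 : r2 * s ≤ Real.sqrt (τ + s) := by
      refine Real.le_sqrt_of_sq_le ?_
      rw [mul_pow, hr22]
      nlinarith
    have t3 : 2 * l * b * s / r2 = (l * b) * (r2 * s) := by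
      rw [div_eq_iff hr20.ne']
      linear_combination (-(l * b * s)) * hr22
    have t4 : r2 ≤ 3 / 2 := by nlinarith
    have t5 : r2 * (l * b) * (r2 * s) ≤ r2 * (l * b) * Real.sqrt (τ + s) := by gcongr
    have t6 : (l * b) * (r2 * s) ≤ (l * b) * (3 / 2 * s) := by gcongr
    have t7 : r2 * (l * b) * (r2 * s) = 2 * (l * b * s) := by
      linear_combination (l * b * s) * hr22
    have t8 : 0 ≤ l * b * s := by positivity
    have t9 : 0 ≤ a * τ := by positivity
    have t10 : 0 ≤ a * s := by positivity
    rw [t3] at hbias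
    nlinarith

end Concentration


section TraceNorm

variable {E F : Type*} [NormedAddCommGroup E] [InnerProductSpace ℝ E] [CompleteSpace E]
  [NormedAddCommGroup F] [InnerProductSpace ℝ F] [CompleteSpace F]

theorem norm_apply_eq_of_comp_self_eq {P : F →L[ℝ] F} {A : F →L[ℝ] E} (hP : P.IsPositive)
    (hPA : P ∘L P = A.adjoint ∘L A) (x : F) : ‖P x‖ = ‖A x‖ := by
  rw [← sq_eq_sq₀ (norm_nonneg _) (norm_nonneg _), ← real_inner_self_eq_norm_sq,
    ← real_inner_self_eq_norm_sq, ← ContinuousLinearMap.adjoint_inner_right,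
    ← ContinuousLinearMap.adjoint_inner_right, hP.isSelfAdjoint.adjoint_eq]
  congr 1
  exact congr($hPA x)

theorem sum_norm_sq_apply_eq {ι κ : Type*} [Fintype ι] [Fintype κ]
    (b : OrthonormalBasis ι ℝ F) (c : OrthonormalBasis κ ℝ F) (D : F →L[ℝ] E) :
    ∑ i, ‖D (b i)‖ ^ 2 = ∑ i, ‖D (c i)‖ ^ 2 := by
  have h : ∀ x, ‖D x‖ ^ 2 = ⟪x, (D.adjoint ∘L D : F →L[ℝ] F) x⟫ := fun x => by
    rw [ContinuousLinearMap.comp_apply, ContinuousLinearMap.adjoint_inner_right,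
      real_inner_self_eq_norm_sq]
  simp_rw [h]
  have h1 := LinearMap.trace_eq_sum_inner (D.adjoint ∘L D : F →L[ℝ] F).toLinearMap b
  have h2 := LinearMap.trace_eq_sum_inner (D.adjoint ∘L D : F →L[ℝ] F).toLinearMap c
  exact h1.symm.trans h2

variable [FiniteDimensional ℝ F]

theorem tsum_inner_eq_trace {ι : Type*} (e : HilbertBasis ι ℝ F) {S : F →L[ℝ] F}
    (hS : S.IsPositive) : ∑' i, ⟪e i, S (e i)⟫ = LinearMap.trace ℝ F S := by
  rw [LinearMap.trace_eq_sum_inner _ (stdOrthonormalBasis ℝ F),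
    tsum_inner_abs_eq_abs_adjoint e (stdOrthonormalBasis ℝ F).toHilbertBasis (A := S) hS hS
      (by rw [hS.isSelfAdjoint.adjoint_eq]) (by rw [hS.isSelfAdjoint.adjoint_eq]), tsum_fintype]
  simp

theorem trace_abs_le_add {ι : Type*} [Fintype ι] (b : OrthonormalBasis ι ℝ F) {A B : F →L[ℝ] E}
    {P Q : F →L[ℝ] F} (hP : P.IsPositive) (hPA : P ∘L P = A.adjoint ∘L A) (hQ : Q.IsPositive)
    (hQB : Q ∘L Q = B.adjoint ∘L B) :
    LinearMap.trace ℝ F P ≤ LinearMap.trace ℝ F Q +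
      Real.sqrt (Module.finrank ℝ F) * Real.sqrt (∑ i, ‖(A - B) (b i)‖ ^ 2) := by
  have hQs : (Q : F →ₗ[ℝ] F).IsSymmetric := hQ.1
  set c := hQs.eigenvectorBasis rfl with hc
  have hQc : ∀ i, ‖Q (c i)‖ = ⟪c i, Q (c i)⟫ := by
    intro i
    have h1 : Q (c i) = (hQs.eigenvalues rfl i : ℝ) • c i :=
      hQs.apply_eigenvectorBasis rfl i
    have h2 : 0 ≤ ⟪c i, Q (c i)⟫ := hQ.inner_nonneg_right _
    rw [h1, real_inner_smul_right, real_inner_self_eq_norm_sq, c.orthonormal.1 i] at h2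
    rw [h1, norm_smul, real_inner_smul_right, real_inner_self_eq_norm_sq, c.orthonormal.1 i]
    simp only [one_pow, mul_one] at h2 ⊢
    exact abs_of_nonneg h2
  have hPc : ∀ i, ⟪c i, P (c i)⟫ ≤ ⟪c i, Q (c i)⟫ + ‖(A - B) (c i)‖ := by
    intro i
    calc ⟪c i, P (c i)⟫ ≤ ‖c i‖ * ‖P (c i)‖ := real_inner_le_norm _ _
      _ = ‖A (c i)‖ := by
        rw [c.orthonormal.1 i, one_mul, norm_apply_eq_of_comp_self_eq hP hPA]
      _ = ‖B (c i) + (A - B) (c i)‖ := by simp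
      _ ≤ ‖B (c i)‖ + ‖(A - B) (c i)‖ := norm_add_le _ _
      _ = _ := by rw [← norm_apply_eq_of_comp_self_eq hQ hQB, hQc]
  have hsum : ∑ i, ‖(A - B) (c i)‖ ≤
      Real.sqrt (Module.finrank ℝ F) * Real.sqrt (∑ i, ‖(A - B) (c i)‖ ^ 2) := by
    have := Real.sum_mul_le_sqrt_mul_sqrt Finset.univ (fun _ => (1 : ℝ))
      (fun i => ‖(A - B) (c i)‖)
    simpa using this
  rw [LinearMap.trace_eq_sum_inner _ c, LinearMap.trace_eq_sum_inner _ c,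
    sum_norm_sq_apply_eq b c]
  refine le_trans (Finset.sum_le_sum fun i _ => hPc i) ?_
  rw [Finset.sum_add_distrib]
  exact add_le_add_right hsum _

theorem trace_eq_of_comp_self_eq {A : F →L[ℝ] E} {P Q : F →L[ℝ] F} (hP : P.IsPositive)
    (hPA : P ∘L P = A.adjoint ∘L A) (hQ : Q.IsPositive) (hQA : Q ∘L Q = A.adjoint ∘L A) :
    LinearMap.trace ℝ F P = LinearMap.trace ℝ F Q := by
  have h1 := trace_abs_le_add (stdOrthonormalBasis ℝ F) hP hPA hQ hQA
  have h2 := trace_abs_le_add (stdOrthonormalBasis ℝ F) hQ hQA hP hPA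
  simp only [sub_self, zero_apply, norm_zero] at h1 h2
  simp only [ne_eq, OfNat.ofNat_ne_zero, not_false_eq_true, zero_pow, Finset.sum_const_zero,
    Real.sqrt_zero, mul_zero, add_zero] at h1 h2
  exact le_antisymm h1 h2

variable {T : Type*} [MeasurableSpace T] {ν : Measure T} [IsProbabilityMeasure ν]

theorem ofReal_one_sub_le_pi_fidelity_sub_le {Φ : T → E} {Ψ : T → F} {κ₁ κ₂ : ℝ}
    (hκ₁ : 0 < κ₁) (hΦm : StronglyMeasurable Φ) (hΨm : StronglyMeasurable Ψ)
    (hΦ : ∀ x, ‖Φ x‖ ≤ κ₁) (hΨ : ∀ x, ‖Ψ x‖ ≤ κ₂) {m : ℕ} (hm : 0 < m) {δ : ℝ}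
    (hδ0 : 0 < δ) (hδ1 : δ < 1) {R : F →L[ℝ] E} (hR : ∀ f, R f = ∫ t, ⟪Ψ t, f⟫ • Φ t ∂ν)
    {RX : (Fin m → T) → F →L[ℝ] E}
    (hRX : ∀ X f, RX X f = (m : ℝ)⁻¹ • ∑ k, ⟪Ψ (X k), f⟫ • Φ (X k))
    {S : F →L[ℝ] F} {SX : (Fin m → T) → F →L[ℝ] F} (hS : S.IsPositive)
    (hSR : S ∘L S = R.adjoint ∘L R) (hSX : ∀ X, (SX X).IsPositive)
    (hSRX : ∀ X, SX X ∘L SX X = (RX X).adjoint ∘L RX X) :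
    ENNReal.ofReal (1 - δ) ≤ (Measure.pi fun _ : Fin m => ν) {X |
      |((m : ℝ)⁻¹ * ∑ j, (‖Φ (X j)‖ ^ 2 + ‖Ψ (X j)‖ ^ 2) - 2 * LinearMap.trace ℝ F (SX X)) -
        ((∫ x, (‖Φ x‖ ^ 2 + ‖Ψ x‖ ^ 2) ∂ν) - 2 * LinearMap.trace ℝ F S)| ≤
      (κ₁ ^ 2 + κ₂ ^ 2) * (2 * Real.log (6 / δ) / m + Real.sqrt (2 * Real.log (6 / δ) / m)) +
        2 * Real.sqrt 2 * κ₁ * κ₂ * Real.sqrt (Module.finrank ℝ F) *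
          Real.sqrt (2 * Real.log (6 / δ) / m + Real.sqrt (2 * Real.log (6 / δ) / m))} := by
  set b := stdOrthonormalBasis ℝ F with hb
  let V := PiLp 2 fun _ : Fin (Module.finrank ℝ F) => E
  let A : V → F →L[ℝ] E := fun v => ∑ i, (innerSL ℝ (b i)).smulRight (v i)
  have hA : ∀ v i, A v (b i) = v i := by
    intro v i
    simp only [A, sum_apply, ContinuousLinearMap.smulRight_apply,
      innerSL_apply_apply, orthonormal_iff_ite.1 b.orthonormal]
    simp
  have hext : ∀ {D D' : F →L[ℝ] E}, (∀ i, D (b i) = D' (b i)) → D = D' := by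
    intro D D' h
    refine ContinuousLinearMap.coe_injective (b.toBasis.ext fun i => ?_)
    simpa using h i
  choose sq hsqpos hsq _ using fun v =>
    ContinuousLinearMap.IsPositive.exists_sqrt
      (ContinuousLinearMap.isPositive_adjoint_comp_self (A v))
  set N : V → ℝ := fun v => LinearMap.trace ℝ F (sq v) with hNdef
  have hle : ∀ v w, N v ≤ N w + Real.sqrt (Module.finrank ℝ F) * ‖v - w‖ := by
    intro v w
    have h := trace_abs_le_add b (hsqpos v) (hsq v) (hsqpos w) (hsq w)
    have h' : Real.sqrt (∑ i, ‖(A v - A w) (b i)‖ ^ 2) = ‖v - w‖ := by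
      rw [PiLp.norm_eq_of_L2]
      simp only [sub_apply, hA]
      rfl
    rwa [h'] at h
  have hN : ∀ v w, |N v - N w| ≤ Real.sqrt (Module.finrank ℝ F) * ‖v - w‖ := by
    intro v w
    have h1 := hle v w
    have h2 := hle w v
    rw [norm_sub_rev] at h2
    rw [abs_le]
    constructor <;> linarith
  let ζ : T → V := fun x => WithLp.toLp 2 fun i => ⟪Ψ x, b i⟫ • Φ x
  have hζm : StronglyMeasurable ζ := by
    have hc : Continuous fun p : E × F =>
        (WithLp.toLp 2 fun i => ⟪p.2, b i⟫ • p.1 : V) :=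
      (PiLp.continuous_toLp 2 _).comp (continuous_pi fun i => by fun_prop)
    exact hc.comp_stronglyMeasurable (hΦm.prodMk hΨm)
  have hζb : ∀ x, ‖ζ x‖ ≤ κ₁ * κ₂ := by
    intro x
    have h1 : ‖ζ x‖ = ‖Φ x‖ * ‖Ψ x‖ := by
      rw [← sq_eq_sq₀ (norm_nonneg _) (by positivity), PiLp.norm_sq_eq_of_L2, mul_pow,
        ← b.sum_sq_norm_inner_left (Ψ x), Finset.mul_sum]
      refine Finset.sum_congr rfl fun i _ => ?_
      simp only [ζ, norm_smul]
      ring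
    rw [h1]
    exact mul_le_mul (hΦ x) (hΨ x) (norm_nonneg _) hκ₁.le
  have hζi : Integrable ζ ν := .of_bound hζm.aestronglyMeasurable _ (.of_forall hζb)
  have hR' : A (∫ x, ζ x ∂ν) = R := by
    refine hext fun i => ?_
    rw [hA, hR]
    exact ((PiLp.proj 2 (fun _ : Fin (Module.finrank ℝ F) => E) i :
      V →L[ℝ] E).integral_comp_comm hζi).symm
  have hRX' : ∀ X : Fin m → T, A ((m : ℝ)⁻¹ • ∑ j, ζ (X j)) = RX X := by
    intro X
    refine hext fun i => ?_
    rw [hA, hRX, PiLp.smul_apply, WithLp.ofLp_sum, Finset.sum_apply]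
  have hNS : N (∫ x, ζ x ∂ν) = LinearMap.trace ℝ F S :=
    trace_eq_of_comp_self_eq (A := R) (hsqpos _) (by rw [← hR']; exact hsq _) hS hSR
  have hNX : ∀ X : Fin m → T, N ((m : ℝ)⁻¹ • ∑ j, ζ (X j)) = LinearMap.trace ℝ F (SX X) :=
    fun X => trace_eq_of_comp_self_eq (A := RX X) (hsqpos _) (by rw [← hRX' X]; exact hsq _)
      (hSX X) (hSRX X)
  have hfm : Measurable fun x => ‖Φ x‖ ^ 2 + ‖Ψ x‖ ^ 2 :=
    (hΦm.norm.measurable.pow_const 2).add (hΨm.norm.measurable.pow_const 2)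
  have key := ofReal_one_sub_le_pi_abs_sub_le (ν := ν) (a := κ₁ ^ 2 + κ₂ ^ 2)
    (by positivity) (Real.sqrt_nonneg _) hfm (fun x => by positivity)
    (fun x => add_le_add (pow_le_pow_left₀ (norm_nonneg _) (hΦ x) 2)
      (pow_le_pow_left₀ (norm_nonneg _) (hΨ x) 2)) hζm hζb hN hm hδ0 hδ1
  simp_rw [hNS, hNX, ← mul_assoc] at key
  simpa only [← mul_assoc] using key

end TraceNorm


section FeatureMaps

variable {T : Type*} {E F : Type*} [NormedAddCommGroup E] [InnerProductSpace ℝ E]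
  [NormedAddCommGroup F] [InnerProductSpace ℝ F]

theorem continuous_of_inner_eq [TopologicalSpace T] {Φ : T → E} {K : T → T → ℝ}
    (hK : Continuous fun p : T × T => K p.1 p.2) (hΦ : ∀ s t, ⟪Φ s, Φ t⟫ = K s t) :
    Continuous Φ := by
  rw [continuous_iff_continuousAt]
  intro t
  rw [ContinuousAt, tendsto_iff_norm_sub_tendsto_zero]
  have h1 : ∀ s, ‖Φ s - Φ t‖ = Real.sqrt (K s s - 2 * K s t + K t t) := by
    intro s
    rw [← hΦ, ← hΦ, ← hΦ, real_inner_self_eq_norm_sq, real_inner_self_eq_norm_sq,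
      ← norm_sub_sq_real, Real.sqrt_sq (norm_nonneg _)]
  have h2 : Continuous fun s => Real.sqrt (K s s - 2 * K s t + K t t) := by
    have h3 : Continuous fun s => K s s := hK.comp (continuous_id.prodMk continuous_id)
    have h4 : Continuous fun s => K s t := hK.comp (continuous_id.prodMk continuous_const)
    exact ((h3.sub (h4.const_mul 2)).add continuous_const).sqrt
  simp_rw [h1]
  refine h2.tendsto' t 0 ?_
  rw [show K t t - 2 * K t t + K t t = 0 by ring, Real.sqrt_zero]

theorem norm_le_of_inner_self_le {Φ : T → E} {K : T → T → ℝ} (hΦ : ∀ s t, ⟪Φ s, Φ t⟫ = K s t)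
    {κ : ℝ} (hκ : 0 < κ) (hK : ∀ x, K x x ≤ κ ^ 2) (x : T) : ‖Φ x‖ ≤ κ := by
  refine le_of_sq_le_sq ?_ hκ.le
  rw [← real_inner_self_eq_norm_sq, hΦ]
  exact hK x

variable [CompleteSpace E] [MeasurableSpace T] {ν : Measure T}

theorem eq_adjoint_comp_of_forall_eq_integral {Φ : T → E} {Ψ : T → F} {S : E →L[ℝ] Lp ℝ 2 ν}
    {S' : F →L[ℝ] Lp ℝ 2 ν} (hS : ∀ g : Lp ℝ 2 ν, S.adjoint g = ∫ t, g t • Φ t ∂ν)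
    (hS' : ∀ f, ⇑(S' f) =ᵐ[ν] fun x => ⟪Ψ x, f⟫) {R : F →L[ℝ] E}
    (hR : ∀ f, R f = ∫ t, ⟪Ψ t, f⟫ • Φ t ∂ν) : R = S.adjoint ∘L S' := by
  ext f
  rw [hR, ContinuousLinearMap.comp_apply, hS]
  refine integral_congr_ae ?_
  filter_upwards [hS' f] with x hx
  rw [hx]

variable [IsProbabilityMeasure ν]

/-- The embedding of the feature space into `L²` and its adjoint, the kernel mean operator. -/
theorem exists_feature_operator {Φ : T → E} {κ : ℝ} (hm : StronglyMeasurable Φ)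
    (hb : ∀ x, ‖Φ x‖ ≤ κ) :
    ∃ S : E →L[ℝ] Lp ℝ 2 ν, (∀ f, ⇑(S f) =ᵐ[ν] fun x => ⟪Φ x, f⟫) ∧
      ∀ g : Lp ℝ 2 ν, S.adjoint g = ∫ t, g t • Φ t ∂ν := by
  have hmem : ∀ f : E, MemLp (fun x => ⟪Φ x, f⟫) 2 ν := fun f =>
    MemLp.of_bound (hm.inner stronglyMeasurable_const).aestronglyMeasurable (κ * ‖f‖)
      (.of_forall fun x => (norm_inner_le_norm _ _).trans (by gcongr; exact hb x))
  have : Nonempty T := nonempty_of_isProbabilityMeasure ν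
  have hκ : 0 ≤ κ := (norm_nonneg _).trans (hb (Classical.arbitrary T))
  let S₀ : E →ₗ[ℝ] Lp ℝ 2 ν :=
    { toFun := fun f => (hmem f).toLp _
      map_add' := fun f g => by
        rw [← MemLp.toLp_add]
        exact MemLp.toLp_congr _ _ (.of_forall fun x => inner_add_right _ _ _)
      map_smul' := fun c f => by
        rw [RingHom.id_apply, ← MemLp.toLp_const_smul]
        exact MemLp.toLp_congr _ _ (.of_forall fun x => inner_smul_right _ _ _) }
  have hS₀ : ∀ f, ⇑(S₀ f) =ᵐ[ν] fun x => ⟪Φ x, f⟫ := fun f => (hmem f).coeFn_toLp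
  let S : E →L[ℝ] Lp ℝ 2 ν := S₀.mkContinuous κ fun f => by
    have h := Lp.norm_le_of_ae_bound (f := S₀ f) (C := κ * ‖f‖) (by positivity) (by
      filter_upwards [hS₀ f] with x hx
      rw [hx]
      exact (norm_inner_le_norm _ _).trans (by gcongr; exact hb x))
    simpa [measureUnivNNReal] using h
  refine ⟨S, hS₀, fun g => ?_⟩
  have hgi : Integrable (fun t => g t • Φ t) ν :=
    ((Lp.memLp g).integrable one_le_two).smul_bdd κ hm.aestronglyMeasurable (.of_forall hb)
  refine ext_inner_left ℝ fun f => ?_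
  rw [ContinuousLinearMap.adjoint_inner_right, L2.inner_def, ← integral_inner hgi]
  refine integral_congr_ae ?_
  filter_upwards [hS₀ f] with x hx
  have hx' : (S f) x = ⟪Φ x, f⟫ := hx
  rw [hx', real_inner_smul_right, real_inner_comm f]
  simp

theorem eq_comp_adjoint_of_forall_eq_integral {Φ : T → E} {κ : ℝ} {K : T → T → ℝ}
    (hΦ : ∀ s t, ⟪Φ s, Φ t⟫ = K s t) (hm : StronglyMeasurable Φ) (hb : ∀ x, ‖Φ x‖ ≤ κ)
    {S : E →L[ℝ] Lp ℝ 2 ν} (hS : ∀ f, ⇑(S f) =ᵐ[ν] fun x => ⟪Φ x, f⟫)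
    (hS' : ∀ g : Lp ℝ 2 ν, S.adjoint g = ∫ t, g t • Φ t ∂ν) {C : Lp ℝ 2 ν →L[ℝ] Lp ℝ 2 ν}
    (hC : ∀ f : Lp ℝ 2 ν, ⇑(C f) =ᵐ[ν] fun x => ∫ t, K x t * f t ∂ν) : C = S ∘L S.adjoint := by
  refine ContinuousLinearMap.ext fun g => Lp.ext ?_
  have hgi : Integrable (fun t => g t • Φ t) ν :=
    ((Lp.memLp g).integrable one_le_two).smul_bdd κ hm.aestronglyMeasurable (.of_forall hb)
  filter_upwards [hC g, hS (S.adjoint g)] with x h1 h2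
  rw [h1, ContinuousLinearMap.comp_apply, h2, hS', ← integral_inner hgi]
  refine integral_congr_ae (.of_forall fun t => ?_)
  simp only [real_inner_smul_right, hΦ, mul_comm]

theorem tsum_inner_eq_integral_norm_sq {Φ : T → E} {κ : ℝ} (hm : StronglyMeasurable Φ)
    (hb : ∀ x, ‖Φ x‖ ≤ κ) {ι : Type*} [Countable ι] (e : HilbertBasis ι ℝ E) {L : E →L[ℝ] E}
    (hL : ∀ u, L u = ∫ t, ⟪Φ t, u⟫ • Φ t ∂ν) :
    ∑' i, ⟪e i, L (e i)⟫ = ∫ x, ‖Φ x‖ ^ 2 ∂ν := by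
  have hintg : ∀ i, Integrable (fun t => ⟪Φ t, e i⟫ • Φ t) ν := fun i => by
    refine .of_bound ((hm.inner stronglyMeasurable_const).smul hm).aestronglyMeasurable (κ * κ)
      (.of_forall fun x => ?_)
    rw [norm_smul]
    have h1 : ‖⟪Φ x, e i⟫‖ ≤ ‖Φ x‖ := by
      simpa [e.orthonormal.1 i] using norm_inner_le_norm (𝕜 := ℝ) (Φ x) (e i)
    exact mul_le_mul (h1.trans (hb x)) (hb x) (norm_nonneg _) ((norm_nonneg _).trans (hb x))
  have h1 : ∀ i, ⟪e i, L (e i)⟫ = ∫ x, ⟪Φ x, e i⟫ ^ 2 ∂ν := by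
    intro i
    rw [hL, ← integral_inner (hintg i)]
    refine integral_congr_ae (.of_forall fun x => ?_)
    simp only [real_inner_smul_right, real_inner_comm (Φ x), sq]
  have h2 : ∀ x, ∑' i, ⟪Φ x, e i⟫ ^ 2 = ‖Φ x‖ ^ 2 := by
    intro x
    rw [← real_inner_self_eq_norm_sq, ← e.tsum_inner_mul_inner]
    simp only [real_inner_comm (Φ x), sq]
  have hmeas : ∀ i, Measurable fun x => ⟪Φ x, e i⟫ ^ 2 := fun i =>
    (hm.inner stronglyMeasurable_const).measurable.pow_const 2
  simp_rw [h1, ← h2]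
  refine (integral_tsum (fun i => (hmeas i).aestronglyMeasurable) ?_).symm
  rw [← lintegral_tsum fun i => (hmeas i).enorm.aemeasurable]
  have h3 : ∀ x, ∑' i, ‖⟪Φ x, e i⟫ ^ 2‖ₑ = ENNReal.ofReal (‖Φ x‖ ^ 2) := by
    intro x
    rw [ofReal_norm_sq_eq_tsum_inner_sq e]
    exact tsum_congr fun i => Real.enorm_of_nonneg (sq_nonneg _)
  simp_rw [h3]
  refine ne_top_of_le_ne_top (b := ENNReal.ofReal (κ ^ 2)) ENNReal.ofReal_ne_top ?_
  calc _ ≤ ∫⁻ _, ENNReal.ofReal (κ ^ 2) ∂ν := lintegral_mono fun x =>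
        ENNReal.ofReal_le_ofReal (pow_le_pow_left₀ (norm_nonneg _) (hb x) 2)
    _ = _ := by simp

end FeatureMaps

section Sampling

open Matrix

variable {T : Type*} {E F : Type*} [NormedAddCommGroup E] [InnerProductSpace ℝ E]
  [CompleteSpace E] [NormedAddCommGroup F] [InnerProductSpace ℝ F]

/-- The rescaled sampling operator and its adjoint. -/
theorem exists_sampling_operator (Φ : T → E) {m : ℕ} (X : Fin m → T) :
    ∃ S : E →L[ℝ] EuclideanSpace ℝ (Fin m), (∀ f k, S f k = Real.sqrt (m : ℝ)⁻¹ * ⟪Φ (X k), f⟫) ∧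
      ∀ g, S.adjoint g = Real.sqrt (m : ℝ)⁻¹ • ∑ k, g k • Φ (X k) := by
  let S : E →L[ℝ] EuclideanSpace ℝ (Fin m) :=
    (PiLp.continuousLinearEquiv 2 ℝ fun _ : Fin m => ℝ).symm.toContinuousLinearMap ∘L
      ContinuousLinearMap.pi fun k => Real.sqrt (m : ℝ)⁻¹ • innerSL ℝ (Φ (X k))
  have hS : ∀ f k, S f k = Real.sqrt (m : ℝ)⁻¹ * ⟪Φ (X k), f⟫ := fun f k => by simp [S]
  refine ⟨S, hS, fun g => ext_inner_left ℝ fun f => ?_⟩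
  rw [ContinuousLinearMap.adjoint_inner_right, PiLp.inner_apply, real_inner_smul_right, inner_sum,
    Finset.mul_sum]
  refine Finset.sum_congr rfl fun k _ => ?_
  rw [hS, real_inner_smul_right, real_inner_comm f]
  simp
  ring

theorem eq_adjoint_comp_of_forall_eq_sum {Φ : T → E} {Ψ : T → F} {m : ℕ} {X : Fin m → T}
    {S : E →L[ℝ] EuclideanSpace ℝ (Fin m)} {S' : F →L[ℝ] EuclideanSpace ℝ (Fin m)}
    (hS : ∀ g, S.adjoint g = Real.sqrt (m : ℝ)⁻¹ • ∑ k, g k • Φ (X k))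
    (hS' : ∀ f k, S' f k = Real.sqrt (m : ℝ)⁻¹ * ⟪Ψ (X k), f⟫) {R : F →L[ℝ] E}
    (hR : ∀ f, R f = (m : ℝ)⁻¹ • ∑ k, ⟪Ψ (X k), f⟫ • Φ (X k)) : R = S.adjoint ∘L S' := by
  ext f
  rw [hR, ContinuousLinearMap.comp_apply, hS]
  simp_rw [hS', ← smul_smul]
  rw [← Finset.smul_sum, smul_smul, Real.mul_self_sqrt (by positivity)]

theorem comp_adjoint_eq_toEuclideanCLM {Φ : T → E} {K : T → T → ℝ}
    (hΦ : ∀ s t, ⟪Φ s, Φ t⟫ = K s t) {m : ℕ} {X : Fin m → T}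
    {S : E →L[ℝ] EuclideanSpace ℝ (Fin m)}
    (hS : ∀ f k, S f k = Real.sqrt (m : ℝ)⁻¹ * ⟪Φ (X k), f⟫)
    (hS' : ∀ g, S.adjoint g = Real.sqrt (m : ℝ)⁻¹ • ∑ k, g k • Φ (X k)) :
    S ∘L S.adjoint = toEuclideanCLM (𝕜 := ℝ)
      ((m : ℝ)⁻¹ • Matrix.of (fun a b => K (X a) (X b))) := by
  ext g k
  rw [ContinuousLinearMap.comp_apply, hS, hS', real_inner_smul_right, ← mul_assoc,
    Real.mul_self_sqrt (by positivity), inner_sum, ofLp_toEuclideanCLM, smul_mulVec,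
    Pi.smul_apply, smul_eq_mul]
  congr 1
  refine Finset.sum_congr rfl fun j _ => ?_
  rw [real_inner_smul_right, hΦ, mul_comm]
  rfl

theorem inner_basisFun_toEuclideanCLM {n : Type*} [Fintype n] [DecidableEq n]
    (M : Matrix n n ℝ) (k : n) :
    ⟪EuclideanSpace.basisFun n ℝ k, toEuclideanCLM (𝕜 := ℝ) M (EuclideanSpace.basisFun n ℝ k)⟫ =
      M k k := by
  rw [inner_toEuclideanCLM]
  simp

theorem trace_eq_tsum_inner_toEuclideanCLM {n : Type*} [Fintype n] [DecidableEq n]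
    (M : Matrix n n ℝ) : M.trace =
      ∑' k, ⟪(EuclideanSpace.basisFun n ℝ).toHilbertBasis k, toEuclideanCLM (𝕜 := ℝ) M
        ((EuclideanSpace.basisFun n ℝ).toHilbertBasis k)⟫ := by
  rw [tsum_fintype]
  simp only [OrthonormalBasis.coe_toHilbertBasis, inner_basisFun_toEuclideanCLM]
  rfl

theorem isPositive_toEuclideanCLM {n : Type*} [Fintype n] [DecidableEq n] {M : Matrix n n ℝ}
    (hM : M.PosSemidef) : (toEuclideanCLM (𝕜 := ℝ) M).IsPositive := by
  rw [← ContinuousLinearMap.isPositive_toLinearMap_iff]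
  exact Matrix.isPositive_toEuclideanLin_iff.2 hM

end Sampling

theorem wasserstein_sq_representation_and_concentration
    {T : Type*} [MetricSpace T] [SigmaCompactSpace T] [MeasurableSpace T] [BorelSpace T]
    (ν : Measure T) [IsProbabilityMeasure ν]
    (K1 K2 : T → T → ℝ)
    (hK1cont : Continuous fun p : T × T => K1 p.1 p.2)
    (hK2cont : Continuous fun p : T × T => K2 p.1 p.2)
    (hK1symm : ∀ s t, K1 s t = K1 t s) (hK2symm : ∀ s t, K2 s t = K2 t s)
    (hK1pos : ∀ (n : ℕ) (x : Fin n → T) (c : Fin n → ℝ),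
      0 ≤ ∑ a, ∑ b, c a * c b * K1 (x a) (x b))
    (hK2pos : ∀ (n : ℕ) (x : Fin n → T) (c : Fin n → ℝ),
      0 ≤ ∑ a, ∑ b, c a * c b * K2 (x a) (x b))
    (κ1 κ2 : ℝ) (hκ1 : 0 < κ1) (hκ2 : 0 < κ2)
    (hbound1 : ∀ x, K1 x x ≤ κ1 ^ 2) (hbound2 : ∀ x, K2 x x ≤ κ2 ^ 2)
    {H1 H2 : Type*} [NormedAddCommGroup H1] [InnerProductSpace ℝ H1] [CompleteSpace H1]
    [NormedAddCommGroup H2] [InnerProductSpace ℝ H2] [CompleteSpace H2]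
    (Φ1 : T → H1) (Φ2 : T → H2)
    (hΦ1 : ∀ s t, ⟪Φ1 s, Φ1 t⟫ = K1 s t) (hΦ2 : ∀ s t, ⟪Φ2 s, Φ2 t⟫ = K2 s t)
    (hdense1 : (Submodule.span ℝ (Set.range Φ1)).topologicalClosure = ⊤)
    (hdense2 : (Submodule.span ℝ (Set.range Φ2)).topologicalClosure = ⊤)
    (C1 C2 : Lp ℝ 2 ν →L[ℝ] Lp ℝ 2 ν)
    (hC1 : ∀ f : Lp ℝ 2 ν, ⇑(C1 f) =ᵐ[ν] fun x => ∫ t, K1 x t * f t ∂ν)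
    (hC2 : ∀ f : Lp ℝ 2 ν, ⇑(C2 f) =ᵐ[ν] fun x => ∫ t, K2 x t * f t ∂ν)
    (R12 : H2 →L[ℝ] H1)
    (hR12 : ∀ f : H2, R12 f = ∫ t, ⟪Φ2 t, f⟫ • Φ1 t ∂ν)
    (L1 : H1 →L[ℝ] H1) (L2 : H2 →L[ℝ] H2)
    (hL1 : ∀ u : H1, L1 u = ∫ t, ⟪Φ1 t, u⟫ • Φ1 t ∂ν)
    (hL2 : ∀ u : H2, L2 u = ∫ t, ⟪Φ2 t, u⟫ • Φ2 t ∂ν)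
    {ιL ι1 ι2 : Type*} [Countable ιL] [Countable ι1] [Countable ι2]
    (eL : HilbertBasis ιL ℝ (Lp ℝ 2 ν))
    (e1 : HilbertBasis ι1 ℝ H1) (e2 : HilbertBasis ι2 ℝ H2)
    (sqC1 : Lp ℝ 2 ν →L[ℝ] Lp ℝ 2 ν)
    (hsqC1 : sqC1.IsPositive ∧ sqC1 ∘L sqC1 = C1)
    (m : ℕ) (hm : 0 < m)
    (L1X : (Fin m → T) → H1 →L[ℝ] H1) (L2X : (Fin m → T) → H2 →L[ℝ] H2)
    (hL1X : ∀ (X : Fin m → T) (u : H1),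
      L1X X u = (m : ℝ)⁻¹ • ∑ k, ⟪Φ1 (X k), u⟫ • Φ1 (X k))
    (hL2X : ∀ (X : Fin m → T) (u : H2),
      L2X X u = (m : ℝ)⁻¹ • ∑ k, ⟪Φ2 (X k), u⟫ • Φ2 (X k))
    (R12X : (Fin m → T) → H2 →L[ℝ] H1)
    (hR12X : ∀ (X : Fin m → T) (f : H2),
      R12X X f = (m : ℝ)⁻¹ • ∑ k, ⟪Φ2 (X k), f⟫ • Φ1 (X k)) :
    -- (i)
    (∀ SM : Lp ℝ 2 ν →L[ℝ] Lp ℝ 2 ν, SM.IsPositive → SM ∘L SM = sqC1 ∘L C2 ∘L sqC1 →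
      ∀ SR : H2 →L[ℝ] H2, SR.IsPositive → SR ∘L SR = R12.adjoint ∘L R12 →
        (∑' k, ⟪(eL k : Lp ℝ 2 ν), C1 (eL k)⟫) + (∑' k, ⟪(eL k : Lp ℝ 2 ν), C2 (eL k)⟫) -
            2 * ∑' k, ⟪(eL k : Lp ℝ 2 ν), SM (eL k)⟫ =
          (∑' k, ⟪(e1 k : H1), L1 (e1 k)⟫) + (∑' k, ⟪(e2 k : H2), L2 (e2 k)⟫) -
            2 * ∑' k, ⟪(e2 k : H2), SR (e2 k)⟫) ∧
    -- (ii)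
    (∀ X : Fin m → T, ∀ Q1 QM : Matrix (Fin m) (Fin m) ℝ,
      Q1.PosSemidef → Q1 * Q1 = (m : ℝ)⁻¹ • Matrix.of (fun a b => K1 (X a) (X b)) →
      QM.PosSemidef →
      QM * QM = Q1 * ((m : ℝ)⁻¹ • Matrix.of (fun a b => K2 (X a) (X b))) * Q1 →
      ∀ SRX : H2 →L[ℝ] H2, SRX.IsPositive → SRX ∘L SRX = (R12X X).adjoint ∘L R12X X →
        ((m : ℝ)⁻¹ • Matrix.of (fun a b => K1 (X a) (X b))).trace +
            ((m : ℝ)⁻¹ • Matrix.of (fun a b => K2 (X a) (X b))).trace -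
            2 * QM.trace =
          (∑' k, ⟪(e1 k : H1), L1X X (e1 k)⟫) + (∑' k, ⟪(e2 k : H2), L2X X (e2 k)⟫) -
            2 * ∑' k, ⟪(e2 k : H2), SRX (e2 k)⟫) ∧
    -- (iii)
    (FiniteDimensional ℝ H2 →
      ∀ δ : ℝ, 0 < δ → δ < 1 →
      ∀ SM : Lp ℝ 2 ν →L[ℝ] Lp ℝ 2 ν, SM.IsPositive → SM ∘L SM = sqC1 ∘L C2 ∘L sqC1 →
        ENNReal.ofReal (1 - δ) ≤
          (Measure.pi fun _ : Fin m => ν) {X : Fin m → T |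
            ∀ Q1 QM : Matrix (Fin m) (Fin m) ℝ,
              Q1.PosSemidef →
              Q1 * Q1 = (m : ℝ)⁻¹ • Matrix.of (fun a b => K1 (X a) (X b)) →
              QM.PosSemidef →
              QM * QM = Q1 * ((m : ℝ)⁻¹ • Matrix.of (fun a b => K2 (X a) (X b))) * Q1 →
              |(((m : ℝ)⁻¹ • Matrix.of (fun a b => K1 (X a) (X b))).trace +
                  ((m : ℝ)⁻¹ • Matrix.of (fun a b => K2 (X a) (X b))).trace -
                  2 * QM.trace) -
                ((∑' k, ⟪(eL k : Lp ℝ 2 ν), C1 (eL k)⟫) +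
                  (∑' k, ⟪(eL k : Lp ℝ 2 ν), C2 (eL k)⟫) -
                  2 * ∑' k, ⟪(eL k : Lp ℝ 2 ν), SM (eL k)⟫)| ≤
                (κ1 ^ 2 + κ2 ^ 2) *
                    (2 * Real.log (6 / δ) / m + Real.sqrt (2 * Real.log (6 / δ) / m)) +
                  2 * Real.sqrt 2 * κ1 * κ2 * Real.sqrt (Module.finrank ℝ H2) *
                    Real.sqrt
                      (2 * Real.log (6 / δ) / m +
                        Real.sqrt (2 * Real.log (6 / δ) / m)) }) := by
  have hΦ1c : Continuous Φ1 := continuous_of_inner_eq hK1cont hΦ1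
  have hΦ2c : Continuous Φ2 := continuous_of_inner_eq hK2cont hΦ2
  have hΦ1m : StronglyMeasurable Φ1 := hΦ1c.stronglyMeasurable
  have hΦ2m : StronglyMeasurable Φ2 := hΦ2c.stronglyMeasurable
  have hΦ1b : ∀ x, ‖Φ1 x‖ ≤ κ1 := norm_le_of_inner_self_le hΦ1 hκ1 hbound1
  have hΦ2b : ∀ x, ‖Φ2 x‖ ≤ κ2 := norm_le_of_inner_self_le hΦ2 hκ2 hbound2
  have population : ∀ SM : Lp ℝ 2 ν →L[ℝ] Lp ℝ 2 ν, SM.IsPositive →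
      SM ∘L SM = sqC1 ∘L C2 ∘L sqC1 →
      ∀ SR : H2 →L[ℝ] H2, SR.IsPositive → SR ∘L SR = R12.adjoint ∘L R12 →
        (∑' k, ⟪(eL k : Lp ℝ 2 ν), C1 (eL k)⟫) + (∑' k, ⟪(eL k : Lp ℝ 2 ν), C2 (eL k)⟫) -
            2 * ∑' k, ⟪(eL k : Lp ℝ 2 ν), SM (eL k)⟫ =
          (∑' k, ⟪(e1 k : H1), L1 (e1 k)⟫) + (∑' k, ⟪(e2 k : H2), L2 (e2 k)⟫) -
            2 * ∑' k, ⟪(e2 k : H2), SR (e2 k)⟫ := by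
    intro SM hSM hSM2 SR hSR hSR2
    obtain ⟨S1, hS1, hS1'⟩ := exists_feature_operator (ν := ν) hΦ1m hΦ1b
    obtain ⟨S2, hS2, hS2'⟩ := exists_feature_operator (ν := ν) hΦ2m hΦ2b
    have hC1' := eq_comp_adjoint_of_forall_eq_integral hΦ1 hΦ1m hΦ1b hS1 hS1' hC1
    have hC2' := eq_comp_adjoint_of_forall_eq_integral hΦ2 hΦ2m hΦ2b hS2 hS2' hC2
    have hL1' := eq_adjoint_comp_of_forall_eq_integral hS1' hS1 hL1
    have hL2' := eq_adjoint_comp_of_forall_eq_integral hS2' hS2 hL2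
    have hR' := eq_adjoint_comp_of_forall_eq_integral hS1' hS2 hR12
    rw [hC1', hC2', hL1', hL2', tsum_inner_adjoint_comp_self e1 eL,
      tsum_inner_adjoint_comp_self e2 eL,
      tsum_inner_fidelity_eq eL e2 S1 S2 hsqC1.1 (hsqC1.2.trans hC1') hSM
        (by rw [hSM2, hC2']) hSR (by rw [hSR2, hR'])]
  have traces : ∀ X : Fin m → T, ∀ Q1 QM : Matrix (Fin m) (Fin m) ℝ,
      Q1.PosSemidef → Q1 * Q1 = (m : ℝ)⁻¹ • Matrix.of (fun a b => K1 (X a) (X b)) →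
      QM.PosSemidef →
      QM * QM = Q1 * ((m : ℝ)⁻¹ • Matrix.of (fun a b => K2 (X a) (X b))) * Q1 →
      ∀ SRX : H2 →L[ℝ] H2, SRX.IsPositive → SRX ∘L SRX = (R12X X).adjoint ∘L R12X X →
        QM.trace = ∑' k, ⟪(e2 k : H2), SRX (e2 k)⟫ := by
    intro X Q1 QM hQ1 hQ1K hQM hQMK SRX hSRX hSRX2
    obtain ⟨S1, hS1, hS1'⟩ := exists_sampling_operator Φ1 X
    obtain ⟨S2, hS2, hS2'⟩ := exists_sampling_operator Φ2 X
    have hR' := eq_adjoint_comp_of_forall_eq_sum hS1' hS2 (hR12X X)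
    rw [trace_eq_tsum_inner_toEuclideanCLM]
    refine tsum_inner_fidelity_eq _ e2 S1 S2 (isPositive_toEuclideanCLM hQ1) ?_
      (isPositive_toEuclideanCLM hQM) ?_ hSRX (by rw [hSRX2, hR'])
    · rw [comp_adjoint_eq_toEuclideanCLM hΦ1 hS1 hS1', ← hQ1K, map_mul]
      rfl
    · rw [comp_adjoint_eq_toEuclideanCLM hΦ2 hS2 hS2']
      change Matrix.toEuclideanCLM (𝕜 := ℝ) QM * Matrix.toEuclideanCLM (𝕜 := ℝ) QM =
        Matrix.toEuclideanCLM (𝕜 := ℝ) Q1 * (Matrix.toEuclideanCLM (𝕜 := ℝ) _ *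
          Matrix.toEuclideanCLM (𝕜 := ℝ) Q1)
      rw [← map_mul, hQMK, map_mul, map_mul, mul_assoc]
  refine ⟨population, ?_, ?_⟩
  · intro X Q1 QM hQ1 hQ1K hQM hQMK SRX hSRX hSRX2
    rw [traces X Q1 QM hQ1 hQ1K hQM hQMK SRX hSRX hSRX2]
    obtain ⟨S1, hS1, hS1'⟩ := exists_sampling_operator Φ1 X
    obtain ⟨S2, hS2, hS2'⟩ := exists_sampling_operator Φ2 X
    rw [eq_adjoint_comp_of_forall_eq_sum hS1' hS1 (hL1X X),
      eq_adjoint_comp_of_forall_eq_sum hS2' hS2 (hL2X X), trace_eq_tsum_inner_toEuclideanCLM,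
      trace_eq_tsum_inner_toEuclideanCLM, ← comp_adjoint_eq_toEuclideanCLM hΦ1 hS1 hS1',
      ← comp_adjoint_eq_toEuclideanCLM hΦ2 hS2 hS2',
      tsum_inner_adjoint_comp_self e1 (EuclideanSpace.basisFun (Fin m) ℝ).toHilbertBasis,
      tsum_inner_adjoint_comp_self e2 (EuclideanSpace.basisFun (Fin m) ℝ).toHilbertBasis]
  · intro hfin δ hδ0 hδ1 SM hSM hSM2
    obtain ⟨SR, hSR, hSR2, -⟩ :=
      (ContinuousLinearMap.isPositive_adjoint_comp_self R12).exists_sqrt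
    choose SX hSX hSX2 _ using fun X =>
      (ContinuousLinearMap.isPositive_adjoint_comp_self (R12X X)).exists_sqrt
    refine (ofReal_one_sub_le_pi_fidelity_sub_le hκ1 hΦ1m hΦ2m hΦ1b hΦ2b hm hδ0 hδ1 hR12 hR12X
      hSR hSR2 hSX hSX2).trans (measure_mono fun X hX => ?_)
    intro Q1 QM hQ1 hQ1K hQM hQMK
    have hi1 : Integrable (fun x => ‖Φ1 x‖ ^ 2) ν :=
      integrable_of_abs_le (M := κ1 ^ 2) (hΦ1m.norm.measurable.pow_const 2) fun x => by
        rw [abs_of_nonneg (by positivity)]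
        exact pow_le_pow_left₀ (norm_nonneg _) (hΦ1b x) 2
    have hi2 : Integrable (fun x => ‖Φ2 x‖ ^ 2) ν :=
      integrable_of_abs_le (M := κ2 ^ 2) (hΦ2m.norm.measurable.pow_const 2) fun x => by
        rw [abs_of_nonneg (by positivity)]
        exact pow_le_pow_left₀ (norm_nonneg _) (hΦ2b x) 2
    have htr : ((m : ℝ)⁻¹ • Matrix.of (fun a b => K1 (X a) (X b))).trace +
        ((m : ℝ)⁻¹ • Matrix.of (fun a b => K2 (X a) (X b))).trace =
        (m : ℝ)⁻¹ * ∑ j, (‖Φ1 (X j)‖ ^ 2 + ‖Φ2 (X j)‖ ^ 2) := by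
      have hk1 : (Matrix.of fun a b => K1 (X a) (X b)).trace = ∑ j, ‖Φ1 (X j)‖ ^ 2 :=
        Finset.sum_congr rfl fun j _ => ((real_inner_self_eq_norm_sq _).symm.trans (hΦ1 _ _)).symm
      have hk2 : (Matrix.of fun a b => K2 (X a) (X b)).trace = ∑ j, ‖Φ2 (X j)‖ ^ 2 :=
        Finset.sum_congr rfl fun j _ => ((real_inner_self_eq_norm_sq _).symm.trans (hΦ2 _ _)).symm
      rw [Matrix.trace_smul, Matrix.trace_smul, smul_eq_mul, smul_eq_mul, ← mul_add,
        Finset.sum_add_distrib, hk1, hk2]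
    rw [population SM hSM hSM2 SR hSR hSR2,
      traces X Q1 QM hQ1 hQ1K hQM hQMK (SX X) (hSX X) (hSX2 X),
      tsum_inner_eq_trace e2 hSR, tsum_inner_eq_trace e2 (hSX X), htr,
      tsum_inner_eq_integral_norm_sq hΦ1m hΦ1b e1 hL1,
      tsum_inner_eq_integral_norm_sq hΦ2m hΦ2b e2 hL2, ← integral_add hi1 hi2]
    exact hX

end
end

section
/- Assume sup_{x∈T} K^i(x,x) ≤ κ_i² for i=1,2, and let ξ¹,ξ² be centered Gaussian processes with covariance functions K¹,K² on probability spaces (Ω₁,P₁),(Ω₂,P₂). Fix X = (x_1,…,x_m) ∈ T^m. Let W¹ = (ω¹_j)_{j=1}^N and W² = (ω²_j)_{j=1}^N be sampled independently from (Ω₁,P₁) and (Ω₂,P₂), and let K̂^i_{W^i}[X] denote the corresponding empirical covariance matrices. Then for every 0 < δ < 1, with probability at least 1−δ (with respect to (P₁⊗P₂)^N), |W₂(N(0,(1/m)K̂¹_{W¹}[X]), N(0,(1/m)K̂²_{W²}[X])) − W₂(N(0,(1/m)K¹[X]), N(0,(1/m)K²[X]))| ≤ 3(κ_1+κ_2)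 √( 4/(Nδ²) + (√m/(√N δ))(3 + 4/(√N δ)) ). -/
/- STATEMENT 7: bounded kernels `sup_x K^i(x,x) ≤ κ_i²`; `ξ¹,ξ²` centered Gaussian processes
with covariances `K¹,K²` (Cramér–Wold encoding) on `(Ω₁,P₁),(Ω₂,P₂)`; `X ∈ T^m` fixed.
For `W = ((ω¹_j,ω²_j))_{j≤N}` i.i.d. from `P₁⊗P₂`, with probability at least `1−δ`:
`|W₂(N(0,(1/m)K̂¹[X]), N(0,(1/m)K̂²[X])) − W₂(N(0,(1/m)K¹[X]), N(0,(1/m)K²[X]))|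
  ≤ 3(κ₁+κ₂)√(4/(Nδ²) + (√m/(√N δ))(3 + 4/(√N δ)))`,
where for PSD matrices `A,B`, `W₂(N(0,A),N(0,B)) = √(tr A + tr B − 2 tr[(A^{1/2}BA^{1/2})^{1/2}])`
(PSD square roots encoded as the unique PSD matrices squaring to the given ones), and
`(K̂^i[X])_{ab} = (1/N) Σ_j ξ^i(ω^i_j,x_a) ξ^i(ω^i_j,x_b)`. -/

open MeasureTheory ProbabilityTheory

noncomputable section

namespace BuresWasserstein
open Matrix

section LinearAlgebra

variable {n : Type*} [Fintype n]

/-- Orthogonal diagonalisation of a real symmetric matrix. -/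
lemma exists_orthogonal_diagonal [DecidableEq n] {A : Matrix n n ℝ} (hA : A.IsHermitian) :
    ∃ (V : Matrix n n ℝ) (d : n → ℝ), Vᵀ * V = 1 ∧ V * Vᵀ = 1 ∧ A = V * diagonal d * Vᵀ := by
  refine ⟨hA.eigenvectorUnitary, hA.eigenvalues, ?_, ?_, ?_⟩
  · simpa [star_eq_conjTranspose] using Unitary.coe_star_mul_self hA.eigenvectorUnitary
  · simpa [star_eq_conjTranspose] using Unitary.coe_mul_star_self hA.eigenvectorUnitary
  · have := hA.spectral_theorem
    rw [Unitary.conjStarAlgAut_apply] at this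
    simpa [star_eq_conjTranspose, Function.comp_def] using this

lemma diagonal_eq_conj [DecidableEq n] {A V : Matrix n n ℝ} {d : n → ℝ} (hV : Vᵀ * V = 1)
    (hA : A = V * diagonal d * Vᵀ) : Vᵀ * A * V = diagonal d := by
  have : Vᵀ * A * V = (Vᵀ * V) * diagonal d * (Vᵀ * V) := by
    rw [hA]; simp only [Matrix.mul_assoc]
  rw [this, hV, Matrix.one_mul, Matrix.mul_one]

lemma trace_conj [DecidableEq n] {V : Matrix n n ℝ} (hV : V * Vᵀ = 1) (A : Matrix n n ℝ) :
    (Vᵀ * A * V).trace = A.trace := by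
  rw [Matrix.trace_mul_comm, ← Matrix.mul_assoc, hV, Matrix.one_mul]

lemma trace_mul_transpose_eq (A B : Matrix n n ℝ) :
    (A * Bᵀ).trace = ∑ i, ∑ j, A i j * B i j := by
  simp [Matrix.trace, Matrix.mul_apply]

lemma trace_mul_transpose_self_nonneg (A : Matrix n n ℝ) : 0 ≤ (A * Aᵀ).trace := by
  rw [trace_mul_transpose_eq]
  exact Finset.sum_nonneg fun i _ => Finset.sum_nonneg fun j _ => mul_self_nonneg _

lemma vecMul_dotProduct_vecMul_self (A : Matrix n n ℝ) (v : n → ℝ) :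
    (v ᵥ* A) ⬝ᵥ (v ᵥ* A) = v ⬝ᵥ ((A * Aᵀ) *ᵥ v) := by
  rw [← Matrix.mulVec_mulVec, Matrix.dotProduct_mulVec, Matrix.mulVec_transpose]

/-- Right multiplication by `U` does not increase the Euclidean norm of row vectors. -/
def IsContraction (U : Matrix n n ℝ) : Prop :=
  ∀ v : n → ℝ, (v ᵥ* U) ⬝ᵥ (v ᵥ* U) ≤ v ⬝ᵥ v

lemma IsContraction.row_le {U : Matrix n n ℝ} (hU : IsContraction U) (A : Matrix n n ℝ) (i : n) :
    ((A * U) * (A * U)ᵀ) i i ≤ (A * Aᵀ) i i := hU (A i)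

lemma IsContraction.trace_le {U : Matrix n n ℝ} (hU : IsContraction U) (A : Matrix n n ℝ) :
    ((A * U) * (A * U)ᵀ).trace ≤ (A * Aᵀ).trace :=
  Finset.sum_le_sum fun i _ => hU.row_le A i

/-- `tr(Uᵀ R) ≤ tr((R Rᵀ)^{1/2})` for every contraction `U`. -/
lemma trace_transpose_mul_le [DecidableEq n] {M R U : Matrix n n ℝ} (hM : M.PosSemidef) (hMR : M * M = R * Rᵀ)
    (hU : IsContraction U) : (Uᵀ * R).trace ≤ M.trace := by
  obtain ⟨V, d, hV, hV', hd⟩ := exists_orthogonal_diagonal hM.1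
  have hdiag := diagonal_eq_conj hV hd
  have hd0 : ∀ i, 0 ≤ d i := fun i => by
    have h := (hM.conjTranspose_mul_mul_same V).diag_nonneg (i := i)
    rw [conjTranspose_eq_transpose_of_trivial, hdiag] at h
    simpa using h
  have h1 : (Uᵀ * R).trace = ((Vᵀ * R) * (Vᵀ * U)ᵀ).trace := by
    rw [Matrix.trace_mul_comm, ← trace_conj hV']
    simp only [Matrix.transpose_mul, Matrix.transpose_transpose, Matrix.mul_assoc]
  have h2 : ∀ i, ((Vᵀ * R) * (Vᵀ * R)ᵀ) i i = d i ^ 2 := fun i => by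
    have : (Vᵀ * R) * (Vᵀ * R)ᵀ = diagonal d * diagonal d := by
      rw [← hdiag]
      calc (Vᵀ * R) * (Vᵀ * R)ᵀ = Vᵀ * (R * Rᵀ) * V := by
            simp only [Matrix.transpose_mul, Matrix.transpose_transpose, Matrix.mul_assoc]
        _ = Vᵀ * M * (V * Vᵀ) * M * V := by
            rw [← hMR, hV', Matrix.mul_one]; simp only [Matrix.mul_assoc]
        _ = _ := by simp only [Matrix.mul_assoc]
    rw [this]; simp [sq]
  have h3 : ∀ i, ((Vᵀ * U) * (Vᵀ * U)ᵀ) i i ≤ 1 := fun i => by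
    simpa [hV] using hU.row_le Vᵀ i
  rw [h1, ← trace_conj hV' M, hdiag, Matrix.trace, Matrix.trace]
  refine Finset.sum_le_sum fun i _ => ?_
  simp only [Matrix.diag_apply, Matrix.diagonal_apply_eq]
  refine abs_le_of_sq_le_sq' ?_ (hd0 i) |>.2
  have hcs := Finset.sum_mul_sq_le_sq_mul_sq Finset.univ (fun k => (Vᵀ * R) i k)
    (fun k => (Vᵀ * U) i k)
  have e : ∀ A B : Matrix n n ℝ, (A * Bᵀ) i i = ∑ k, A i k * B i k := fun A B => by
    simp [Matrix.mul_apply]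
  have h2' := h2 i
  have h3' := h3 i
  rw [e] at h2' h3' ⊢
  simp only [← sq] at h2' h3'
  rw [h2'] at hcs
  nlinarith [sq_nonneg (d i)]

/-- The trace of `(R Rᵀ)^{1/2}` is attained as `tr(Uᵀ R)` for some contraction `U`. -/
lemma exists_contraction_trace_eq [DecidableEq n] {M R : Matrix n n ℝ} (hM : M.IsHermitian)
    (hMR : M * M = R * Rᵀ) : ∃ U, IsContraction U ∧ (Uᵀ * R).trace = M.trace := by
  obtain ⟨V, d, hV, hV', hd⟩ := exists_orthogonal_diagonal hM
  have hRR : R * Rᵀ = V * diagonal (fun i => d i * d i) * Vᵀ := by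
    rw [← hMR, hd, ← Matrix.diagonal_mul_diagonal]
    calc _ = V * diagonal d * (Vᵀ * V) * diagonal d * Vᵀ := by simp only [Matrix.mul_assoc]
      _ = _ := by rw [hV]; simp only [Matrix.mul_assoc, Matrix.mul_one]
  set D : Matrix n n ℝ := diagonal fun i => (d i)⁻¹ with hD
  have hDt : Dᵀ = D := Matrix.diagonal_transpose _
  refine ⟨V * D * Vᵀ * R, fun v => ?_, ?_⟩
  · have key : v ⬝ᵥ v = (v ᵥ* V) ⬝ᵥ (v ᵥ* V) := by
      rw [vecMul_dotProduct_vecMul_self, hV', Matrix.one_mulVec]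
    have e : (v ᵥ* (V * D * Vᵀ * R)) ⬝ᵥ (v ᵥ* (V * D * Vᵀ * R)) =
        (v ᵥ* V) ⬝ᵥ ((diagonal fun i => (d i)⁻¹ * (d i * d i) * (d i)⁻¹) *ᵥ (v ᵥ* V)) := by
      rw [← Matrix.diagonal_mul_diagonal, ← Matrix.diagonal_mul_diagonal, ← hD]
      have h : V * D * Vᵀ * R * (V * D * Vᵀ * R)ᵀ
          = V * (D * diagonal (fun i => d i * d i) * D) * Vᵀ := by
        calc _ = V * D * Vᵀ * (R * Rᵀ) * V * D * Vᵀ := by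
              simp only [Matrix.transpose_mul, Matrix.transpose_transpose, Matrix.mul_assoc, hDt]
          _ = V * D * (Vᵀ * V) * diagonal (fun i => d i * d i) * (Vᵀ * V) * D * Vᵀ := by
              rw [hRR]; simp only [Matrix.mul_assoc]
          _ = _ := by rw [hV]; simp only [Matrix.mul_assoc, Matrix.one_mul]
      rw [vecMul_dotProduct_vecMul_self, h, Matrix.mul_assoc, ← Matrix.mulVec_mulVec,
        ← Matrix.mulVec_mulVec, Matrix.dotProduct_mulVec, Matrix.mulVec_transpose]
    rw [e, key]
    simp only [dotProduct, Matrix.mulVec_diagonal]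
    refine Finset.sum_le_sum fun i _ => ?_
    rcases eq_or_ne (d i) 0 with h | h
    · simp [h, mul_self_nonneg]
    · apply le_of_eq; field_simp
  · calc ((V * D * Vᵀ * R)ᵀ * R).trace = (Vᵀ * (R * Rᵀ) * V * D).trace := by
          simp only [Matrix.transpose_mul, Matrix.transpose_transpose, hDt]
          rw [show Rᵀ * (V * (D * Vᵀ)) * R = Rᵀ * (V * D * Vᵀ * R) by
            simp only [Matrix.mul_assoc], Matrix.trace_mul_comm,
            show V * D * Vᵀ * R * Rᵀ = V * D * (Vᵀ * (R * Rᵀ)) by simp only [Matrix.mul_assoc],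
            Matrix.trace_mul_comm]
          simp only [Matrix.mul_assoc]
      _ = (diagonal (fun i => d i * d i) * D).trace := by rw [diagonal_eq_conj hV hRR]
      _ = (diagonal d).trace := by
          rw [hD, Matrix.diagonal_mul_diagonal]
          congr 2; ext i
          rcases eq_or_ne (d i) 0 with h | h
          · simp [h]
          · field_simp
      _ = M.trace := by rw [← diagonal_eq_conj hV hd, trace_conj hV']

lemma abs_le_sqrt_mul_sqrt_of_quadratic_nonneg {a b c : ℝ}
    (h : ∀ t : ℝ, 0 ≤ a + 2 * b * t + c * t ^ 2) : |b| ≤ √a * √c := by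
  have hd : discrim c (2 * b) a ≤ 0 := discrim_le_zero fun t => by nlinarith [h t]
  have ha : 0 ≤ a := by simpa using h 0
  rw [← Real.sqrt_mul ha]
  apply Real.abs_le_sqrt
  unfold discrim at hd
  nlinarith

/-- The squared transport cost between the factors `A`, `B` coupled through `U`. -/
def cost (U A B : Matrix n n ℝ) : ℝ :=
  (A * Aᵀ).trace + (B * Bᵀ).trace - 2 * (A * U * Bᵀ).trace

lemma cost_nonneg {U : Matrix n n ℝ} (hU : IsContraction U) (A B : Matrix n n ℝ) :
    0 ≤ cost U A B := by
  have h1 := trace_mul_transpose_self_nonneg (A * U - B)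
  have h2 := hU.trace_le A
  have h3 : (B * (A * U)ᵀ).trace = (A * U * Bᵀ).trace := by
    rw [← Matrix.trace_transpose, Matrix.transpose_mul, Matrix.transpose_transpose]
  rw [Matrix.transpose_sub, Matrix.sub_mul, Matrix.mul_sub, Matrix.mul_sub, Matrix.trace_sub,
    Matrix.trace_sub, Matrix.trace_sub, h3] at h1
  unfold cost
  linarith

/-- The polarisation of `cost U`. -/
def costBilin (U A B C D : Matrix n n ℝ) : ℝ :=
  (A * Cᵀ).trace + (B * Dᵀ).trace - (A * U * Dᵀ).trace - (C * U * Bᵀ).trace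

lemma cost_add_smul (U A B C D : Matrix n n ℝ) (t : ℝ) :
    cost U (A + t • C) (B + t • D) =
      cost U A B + 2 * costBilin U A B C D * t + cost U C D * t ^ 2 := by
  have h (E F : Matrix n n ℝ) : (F * Eᵀ).trace = (E * Fᵀ).trace := by
    rw [← Matrix.trace_transpose, Matrix.transpose_mul, Matrix.transpose_transpose]
  simp only [cost, costBilin, Matrix.transpose_add, Matrix.transpose_smul, Matrix.add_mul,
    Matrix.mul_add, Matrix.smul_mul, Matrix.mul_smul, Matrix.trace_add, Matrix.trace_smul,
    smul_eq_mul, h A C, h B D]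
  ring

lemma cost_le_add_sq {U : Matrix n n ℝ} (hU : IsContraction U) (C D : Matrix n n ℝ) :
    cost U C D ≤ (√(C * Cᵀ).trace + √(D * Dᵀ).trace) ^ 2 := by
  have h := abs_le_sqrt_mul_sqrt_of_quadratic_nonneg (a := (C * Cᵀ).trace)
    (b := -(C * U * Dᵀ).trace) (c := (D * Dᵀ).trace) fun t => by
      have := cost_nonneg hU C (t • D)
      simp only [cost, Matrix.transpose_smul, Matrix.smul_mul, Matrix.mul_smul,
        Matrix.trace_smul, smul_eq_mul] at this
      linarith
  have h' := (abs_le.1 h).2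
  rw [add_sq, Real.sq_sqrt (trace_mul_transpose_self_nonneg C),
    Real.sq_sqrt (trace_mul_transpose_self_nonneg D), cost]
  linarith

lemma sqrt_cost_le {U : Matrix n n ℝ} (hU : IsContraction U) (A B A' B' : Matrix n n ℝ) :
    √(cost U A' B') ≤ √(cost U A B) +
      (√((A' - A) * (A' - A)ᵀ).trace + √((B' - B) * (B' - B)ᵀ).trace) := by
  have h := abs_le_sqrt_mul_sqrt_of_quadratic_nonneg (a := cost U A B)
    (b := costBilin U A B (A' - A) (B' - B)) (c := cost U (A' - A) (B' - B)) fun t => by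
      rw [← cost_add_smul]; exact cost_nonneg hU _ _
  have h1 := cost_add_smul U A B (A' - A) (B' - B) 1
  simp only [one_smul, add_sub_cancel] at h1
  have h2 : √(cost U (A' - A) (B' - B)) ≤ _ :=
    Real.sqrt_le_iff.2 ⟨by positivity, cost_le_add_sq hU (A' - A) (B' - B)⟩
  refine le_trans (Real.sqrt_le_iff.2 ⟨by positivity, ?_⟩) (add_le_add_right h2 _)
  rw [h1, add_sq, Real.sq_sqrt (cost_nonneg hU _ _), Real.sq_sqrt (cost_nonneg hU _ _)]
  linarith [(abs_le.1 h).2]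

/-- The Gaussian Wasserstein distance is controlled by the Frobenius distance of the square roots
of the covariance matrices. -/
lemma sqrt_trace_le [DecidableEq n] {P Q M P' Q' M' : Matrix n n ℝ} (hP : P.IsHermitian) (hQ : Q.IsHermitian)
    (hM : M.PosSemidef) (hMM : M * M = P * (Q * Q) * P)
    (hP' : P'.IsHermitian) (hQ' : Q'.IsHermitian)
    (hM' : M'.PosSemidef) (hMM' : M' * M' = P' * (Q' * Q') * P') :
    √((P' * P').trace + (Q' * Q').trace - 2 * M'.trace) ≤
      √((P * P).trace + (Q * Q).trace - 2 * M.trace) +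
      (√((P' - P) * (P' - P)ᵀ).trace + √((Q' - Q) * (Q' - Q)ᵀ).trace) := by
  have ht {E : Matrix n n ℝ} (hE : E.IsHermitian) : Eᵀ = E := by
    simpa using hE.eq
  have hc {E F : Matrix n n ℝ} (hE : E.IsHermitian) (hF : F.IsHermitian) (U : Matrix n n ℝ) :
      cost U E F = (E * E).trace + (F * F).trace - 2 * (Uᵀ * (E * F)).trace := by
    rw [cost, ht hE, ht hF, ← Matrix.trace_transpose (E * U * F), Matrix.transpose_mul,
      Matrix.transpose_mul, ht hE, ht hF, Matrix.trace_mul_comm F (Uᵀ * E), Matrix.mul_assoc]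
  obtain ⟨U, hU, hUM⟩ := exists_contraction_trace_eq (R := P * Q) hM.1
    (by rw [hMM, Matrix.transpose_mul, ht hP, ht hQ]; simp only [Matrix.mul_assoc])
  have h := trace_transpose_mul_le (R := P' * Q') hM'
    (by rw [hMM', Matrix.transpose_mul, ht hP', ht hQ']; simp only [Matrix.mul_assoc]) hU
  have hs := sqrt_cost_le hU P Q P' Q'
  rw [hc hP hQ, hc hP' hQ', hUM] at hs
  refine le_trans (Real.sqrt_le_sqrt ?_) hs
  linarith

/-- A Powers–Størmer type inequality. -/
lemma trace_sub_sq_le [DecidableEq n] {P P' : Matrix n n ℝ} (hP : P.PosSemidef) (hP' : P'.PosSemidef) :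
    ((P' - P) * (P' - P)ᵀ).trace ≤
      √(Fintype.card n) * √(((P' * P' - P * P) * (P' * P' - P * P)ᵀ).trace) := by
  have hS : (P' - P).IsHermitian := hP'.1.sub hP.1
  have hSt : (P' - P)ᵀ = P' - P := by simpa using hS.eq
  obtain ⟨V, s, hV, hV', hs⟩ := exists_orthogonal_diagonal hS
  have hdiag := diagonal_eq_conj hV hs
  set G := P' * P' - P * P with hG
  have h2G : Vᵀ * G * V + Vᵀ * G * V = diagonal s * (Vᵀ * (P' + P) * V) +
      (Vᵀ * (P' + P) * V) * diagonal s := by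
    have e1 : diagonal s * (Vᵀ * (P' + P) * V) = Vᵀ * ((P' - P) * (P' + P)) * V := by
      rw [← hdiag]
      calc _ = Vᵀ * (P' - P) * (V * Vᵀ) * (P' + P) * V := by simp only [Matrix.mul_assoc]
        _ = _ := by rw [hV', Matrix.mul_one]; simp only [Matrix.mul_assoc]
    have e2 : (Vᵀ * (P' + P) * V) * diagonal s = Vᵀ * ((P' + P) * (P' - P)) * V := by
      rw [← hdiag]
      calc _ = Vᵀ * (P' + P) * (V * Vᵀ) * (P' - P) * V := by simp only [Matrix.mul_assoc]
        _ = _ := by rw [hV', Matrix.mul_one]; simp only [Matrix.mul_assoc]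
    rw [e1, e2, hG]
    noncomm_ring
  have hq : ∀ {E : Matrix n n ℝ}, E.PosSemidef → ∀ i, 0 ≤ (Vᵀ * E * V) i i := fun hE i => by
    have h := (hE.conjTranspose_mul_mul_same V).diag_nonneg (i := i)
    rwa [conjTranspose_eq_transpose_of_trivial] at h
  have hle : ∀ i, s i ^ 2 ≤ |(Vᵀ * G * V) i i| := fun i => by
    have e1 : (Vᵀ * G * V) i i = s i * (Vᵀ * (P' + P) * V) i i := by
      have := congrFun (congrFun h2G i) i
      simp only [Matrix.add_apply, Matrix.diagonal_mul, Matrix.mul_diagonal] at this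
      linarith
    have e2 : s i = (Vᵀ * P' * V) i i - (Vᵀ * P * V) i i := by
      have := congrFun (congrFun hdiag i) i
      rw [Matrix.mul_sub, Matrix.sub_mul] at this
      simpa using this.symm
    have e3 : (Vᵀ * (P' + P) * V) i i = (Vᵀ * P' * V) i i + (Vᵀ * P * V) i i := by
      rw [Matrix.mul_add, Matrix.add_mul, Matrix.add_apply]
    have h4 : |s i| ≤ (Vᵀ * (P' + P) * V) i i := by
      rw [e3, e2, abs_le]
      constructor <;> linarith [hq hP' i, hq hP i]
    rw [e1, abs_mul, ← sq_abs, sq]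
    exact mul_le_mul_of_nonneg_left (h4.trans (le_abs_self _)) (abs_nonneg _)
  have hfrob : ∑ i, |(Vᵀ * G * V) i i| ^ 2 ≤ (G * Gᵀ).trace := by
    have : (G * Gᵀ).trace = ((Vᵀ * G * V) * (Vᵀ * G * V)ᵀ).trace := by
      rw [← trace_conj hV' (G * Gᵀ)]
      congr 1
      calc _ = Vᵀ * G * 1 * Gᵀ * V := by simp only [Matrix.mul_assoc, Matrix.one_mul]
        _ = _ := by
          rw [← hV']
          simp only [Matrix.transpose_mul, Matrix.transpose_transpose, Matrix.mul_assoc]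
    rw [this, trace_mul_transpose_eq]
    refine Finset.sum_le_sum fun i _ => ?_
    rw [sq_abs, sq]
    exact Finset.single_le_sum (f := fun j => (Vᵀ * G * V) i j * (Vᵀ * G * V) i j)
      (fun j _ => mul_self_nonneg _) (Finset.mem_univ i)
  have htr : ((P' - P) * (P' - P)ᵀ).trace = ∑ i, s i ^ 2 := by
    rw [hSt, ← trace_conj hV' ((P' - P) * (P' - P))]
    have : Vᵀ * ((P' - P) * (P' - P)) * V = diagonal s * diagonal s := by
      rw [← hdiag]
      calc _ = Vᵀ * (P' - P) * 1 * (P' - P) * V := by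
            simp only [Matrix.mul_assoc, Matrix.one_mul]
        _ = _ := by rw [← hV']; simp only [Matrix.mul_assoc]
    rw [this]
    simp [Matrix.trace, sq]
  rw [htr, ← Real.sqrt_mul (Nat.cast_nonneg _)]
  refine (Finset.sum_le_sum fun i _ => hle i).trans (Real.le_sqrt_of_sq_le ?_)
  refine (sq_sum_le_card_mul_sum_sq).trans ?_
  rw [Finset.card_univ]
  gcongr

lemma exists_posSemidef_sqrt [DecidableEq n] {A : Matrix n n ℝ} (hA : A.PosSemidef) :
    ∃ Q : Matrix n n ℝ, Q.PosSemidef ∧ Q * Q = A := by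
  open scoped MatrixOrder in
  exact ⟨CFC.sqrt A, (CFC.sqrt_nonneg A).posSemidef, CFC.sqrt_mul_sqrt_self A hA.nonneg⟩

end LinearAlgebra

section Probability

variable {Ω : Type*} [MeasurableSpace Ω] {P : Measure Ω}

lemma integral_pow_four_le_of_gaussian {Z : Ω → ℝ} (hZ : Measurable Z) {v : NNReal}
    (hlaw : P.map Z = gaussianReal 0 v) {κ : ℝ} (hκ : 0 < κ) (hv : (v : ℝ) ≤ κ ^ 2) :
    ∫ ω, Z ω ^ 4 ∂P ≤ 96 * κ ^ 4 := by
  have h1 : ∫ ω, Z ω ^ 4 ∂P = ∫ x, x ^ 4 ∂(gaussianReal 0 v) := by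
    rw [← hlaw, integral_map hZ.aemeasurable (by fun_prop)]
  have hmgf : ∀ t : ℝ, ∫ x, Real.exp (t * x) ∂(gaussianReal 0 v) = Real.exp (v * t ^ 2 / 2) :=
    fun t => by simpa [mgf] using congrFun (mgf_fun_id_gaussianReal (μ := 0) (v := v)) t
  have hpt : ∀ x : ℝ,
      x ^ 4 ≤ 24 * κ ^ 4 * (Real.exp (κ⁻¹ * x) + Real.exp (-κ⁻¹ * x)) := fun x => by
    have h := Real.pow_div_factorial_le_exp (x := |κ⁻¹ * x|) (abs_nonneg _) 4
    have h' : Real.exp |κ⁻¹ * x| ≤ Real.exp (κ⁻¹ * x) + Real.exp (-κ⁻¹ * x) := by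
      rcases abs_cases (κ⁻¹ * x) with ⟨e, -⟩ | ⟨e, -⟩ <;> rw [e]
      · exact le_add_of_nonneg_right (Real.exp_pos _).le
      · rw [neg_mul]; exact le_add_of_nonneg_left (Real.exp_pos _).le
    have h24 : ((Nat.factorial 4 : ℕ) : ℝ) = 24 := by norm_num [Nat.factorial]
    rw [h24, Even.pow_abs (by decide), mul_pow] at h
    have h'' := h.trans h'
    have hk : κ ^ 4 * κ⁻¹ ^ 4 = 1 := by rw [← mul_pow, mul_inv_cancel₀ hκ.ne', one_pow]
    calc x ^ 4 = 24 * κ ^ 4 * (κ⁻¹ ^ 4 * x ^ 4 / 24) := by linear_combination (-x ^ 4) * hk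
      _ ≤ _ := by gcongr
  have hint := fun t : ℝ => integrable_exp_mul_gaussianReal (μ := 0) (v := v) t
  have hexp : Real.exp (v * κ⁻¹ ^ 2 / 2) ≤ 2 := by
    have h2 : (v : ℝ) * κ⁻¹ ^ 2 ≤ 1 := by
      rw [inv_pow, ← div_eq_mul_inv]; exact div_le_one_of_le₀ hv (by positivity)
    have h3 : Real.exp (1 / 2) ^ 2 ≤ 2 ^ 2 := by
      rw [← Real.exp_nat_mul]; norm_num; linarith [Real.exp_one_lt_d9]
    calc _ ≤ Real.exp (1 / 2) := Real.exp_le_exp.2 (by linarith)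
      _ ≤ 2 := le_of_sq_le_sq h3 (by norm_num)
  rw [h1]
  calc ∫ x, x ^ 4 ∂(gaussianReal 0 v)
      ≤ ∫ x, 24 * κ ^ 4 * (Real.exp (κ⁻¹ * x) + Real.exp (-κ⁻¹ * x)) ∂(gaussianReal 0 v) :=
        integral_mono_of_nonneg (ae_of_all _ fun x => by positivity)
          (((hint _).add (hint _)).const_mul _) (ae_of_all _ hpt)
    _ = 24 * κ ^ 4 * (2 * Real.exp (v * κ⁻¹ ^ 2 / 2)) := by
        rw [integral_const_mul, integral_add (hint _) (hint _), hmgf, hmgf, neg_sq, two_mul]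
    _ ≤ 96 * κ ^ 4 := by nlinarith [pow_pos hκ 4]

lemma memLp_of_gaussian {Z : Ω → ℝ} (hZ : Measurable Z) {v : NNReal}
    (hlaw : P.map Z = gaussianReal 0 v) (p : ENNReal) (hp : p ≠ ⊤) : MemLp Z p P := by
  have h := memLp_id_gaussianReal' (μ := 0) (v := v) p hp
  rw [← hlaw] at h
  exact (memLp_map_measure_iff (by fun_prop) hZ.aemeasurable).1 h

lemma integral_sq_of_gaussian {Z : Ω → ℝ} (hZ : Measurable Z) {v : NNReal}
    (hlaw : P.map Z = gaussianReal 0 v) : ∫ ω, Z ω ^ 2 ∂P = v := by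
  have h := variance_fun_id_gaussianReal (μ := 0) (v := v)
  rw [variance_of_integral_eq_zero (by fun_prop) (by simp)] at h
  rw [← h, ← hlaw, integral_map hZ.aemeasurable (by fun_prop)]

/-- The second moments of a centered Gaussian process are given by its covariance function. -/
lemma integral_mul_of_gaussian {T : Type*} {K : T → T → ℝ} {ξ : Ω → T → ℝ}
    (hsymm : ∀ s t, K s t = K t s)
    (hpos : ∀ (n : ℕ) (x : Fin n → T) (c : Fin n → ℝ), 0 ≤ ∑ a, ∑ b, c a * c b * K (x a) (x b))
    (hmeas : ∀ t, Measurable fun ω => ξ ω t)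
    (hGauss : ∀ (n : ℕ) (x : Fin n → T) (a : Fin n → ℝ),
      P.map (fun ω => ∑ i, a i * ξ ω (x i)) =
        gaussianReal 0 (∑ i, ∑ j, a i * a j * K (x i) (x j)).toNNReal) (s t : T) :
    ∫ ω, ξ ω s * ξ ω t ∂P = K s t := by
  have h1 : ∀ u, ∫ ω, ξ ω u ^ 2 ∂P = K u u := fun u => by
    have h := hGauss 1 (fun _ => u) (fun _ => 1)
    have hp := hpos 1 (fun _ => u) (fun _ => 1)
    simp only [Finset.univ_unique, Finset.sum_singleton, one_mul] at h hp
    rw [integral_sq_of_gaussian (hmeas u) h, Real.coe_toNNReal _ hp]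
  have hL : ∀ u, MemLp (fun ω => ξ ω u) 2 P := fun u => by
    have h := hGauss 1 (fun _ => u) (fun _ => 1)
    simp only [Finset.univ_unique, Finset.sum_singleton, one_mul] at h
    exact memLp_of_gaussian (hmeas u) h 2 (by simp)
  have h2 : ∫ ω, (ξ ω s + ξ ω t) ^ 2 ∂P = K s s + K s t + (K t s + K t t) := by
    have h := hGauss 2 ![s, t] ![1, 1]
    have hp := hpos 2 ![s, t] ![1, 1]
    simp only [Fin.sum_univ_two, Matrix.cons_val_zero, Matrix.cons_val_one, one_mul] at h hp
    rw [integral_sq_of_gaussian (Z := fun ω => ξ ω s + ξ ω t) ((hmeas s).add (hmeas t)) h, Real.coe_toNNReal _ hp]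
  have h3 : ∫ ω, (ξ ω s + ξ ω t) ^ 2 ∂P =
      ∫ ω, ξ ω s ^ 2 ∂P + 2 * ∫ ω, ξ ω s * ξ ω t ∂P + ∫ ω, ξ ω t ^ 2 ∂P := by
    have i1 := (hL s).integrable_sq
    have i2 : Integrable (fun ω => 2 * (ξ ω s * ξ ω t)) P :=
      ((hL s).integrable_mul (hL t)).const_mul 2
    have i3 := (hL t).integrable_sq
    rw [← integral_const_mul, ← integral_add i1 i2,
      ← integral_add (f := fun ω => ξ ω s ^ 2 + 2 * (ξ ω s * ξ ω t)) (i1.add i2) i3]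
    congr 1; ext ω; ring
  rw [h2, h1, h1, hsymm t s] at h3
  linarith

variable [IsProbabilityMeasure P]

/-- The mean of `N` independent copies of `Y` has mean square error at most `E[Y²] / N`. -/
lemma integral_empirical_sq_le {Y : Ω → ℝ} (hY : MemLp Y 2 P) {N : ℕ} (hN : 0 < N) :
    Integrable (fun W : Fin N → Ω => ((N : ℝ)⁻¹ * ∑ j, Y (W j) - ∫ ω, Y ω ∂P) ^ 2)
      (Measure.pi fun _ => P) ∧
    ∫ W : Fin N → Ω, ((N : ℝ)⁻¹ * ∑ j, Y (W j) - ∫ ω, Y ω ∂P) ^ 2 ∂(Measure.pi fun _ => P) ≤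
      (∫ ω, Y ω ^ 2 ∂P) / N := by
  have hN' : (N : ℝ) ≠ 0 := by positivity
  have hj : ∀ j : Fin N, MemLp (fun W : Fin N → Ω => Y (W j)) 2 (Measure.pi fun _ => P) :=
    fun j => hY.comp_measurePreserving (measurePreserving_eval (fun _ => P) j)
  have hS : MemLp (fun W : Fin N → Ω => (N : ℝ)⁻¹ * ∑ j, Y (W j)) 2 (Measure.pi fun _ => P) :=
    (memLp_finsetSum _ fun j _ => hj j).const_mul _
  have hmean : ∫ W : Fin N → Ω, (N : ℝ)⁻¹ * ∑ j, Y (W j) ∂(Measure.pi fun _ => P) =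
      ∫ ω, Y ω ∂P := by
    rw [integral_const_mul, integral_finsetSum _ fun j _ => (hj j).integrable one_le_two]
    have : ∀ j : Fin N, ∫ W : Fin N → Ω, Y (W j) ∂(Measure.pi fun _ => P) = ∫ ω, Y ω ∂P :=
      fun j => by
        have h := (measurePreserving_eval (fun _ : Fin N => P) j).map_eq
        conv_rhs => rw [← h]
        rw [integral_map (measurable_pi_apply j).aemeasurable (by rw [h]; exact hY.1)]
    simp only [this, Finset.sum_const, Finset.card_univ, Fintype.card_fin, nsmul_eq_mul]
    field_simp
  refine ⟨(hS.sub (memLp_const _)).integrable_sq, ?_⟩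
  have hvar := variance_eq_integral hS.1.aemeasurable
  rw [hmean] at hvar
  rw [← hvar, variance_const_mul]
  have hsum := variance_sum_pi (X := fun _ : Fin N => Y) (μ := fun _ => P) fun _ => hY
  have he : (∑ i : Fin N, fun W : Fin N → Ω => Y (W i)) = fun W => ∑ i, Y (W i) := by
    ext W; simp
  rw [he] at hsum
  rw [hsum, Finset.sum_const, Finset.card_univ, Fintype.card_fin, nsmul_eq_mul]
  have hle := variance_le_expectation_sq (μ := P) hY.1
  simp only [Pi.pow_apply] at hle
  calc _ = Var[Y; P] / N := by field_simp
    _ ≤ _ := by gcongr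

/-- Concentration in Frobenius norm of a scaled empirical second moment matrix. -/
lemma measure_empirical_covariance_ge_le {m : ℕ} (hm : 0 < m) {Z : Fin m → Ω → ℝ}
    {C : Fin m → Fin m → ℝ} (hZ : ∀ a, MemLp (Z a) 4 P) {B : ℝ}
    (hB : ∀ a, ∫ ω, Z a ω ^ 4 ∂P ≤ B) (hB0 : 0 < B)
    (hC : ∀ a b, ∫ ω, Z a ω * Z b ω ∂P = C a b) {N : ℕ} (hN : 0 < N) {δ : ℝ} (hδ : 0 < δ) :
    (Measure.pi fun _ : Fin N => P) {W | 2 * B / (N * δ) ≤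
      ∑ a, ∑ b, ((m : ℝ)⁻¹ * ((N : ℝ)⁻¹ * ∑ j, Z a (W j) * Z b (W j)) -
        (m : ℝ)⁻¹ * C a b) ^ 2} ≤ ENNReal.ofReal (δ / 2) := by
  have hY : ∀ a b, MemLp (fun ω => Z a ω * Z b ω) 2 P := fun a b =>
    (hZ b).mul' (hpqr := ⟨by
      rw [← ENNReal.toReal_eq_toReal_iff' (by simp) (by simp), ENNReal.toReal_add (by simp)
        (by simp)]
      norm_num⟩) (hZ a)
  have h4 : ∀ a, Integrable (fun ω => Z a ω ^ 4) P := fun a => by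
    have h := (hY a a).integrable_sq
    refine h.congr (ae_of_all _ fun ω => by ring)
  have hY2 : ∀ a b, ∫ ω, (Z a ω * Z b ω) ^ 2 ∂P ≤ B := fun a b => by
    calc _ ≤ ∫ ω, (1 / 2 : ℝ) * (Z a ω ^ 4 + Z b ω ^ 4) ∂P :=
          integral_mono (hY a b).integrable_sq (((h4 a).add (h4 b)).const_mul _) fun ω => by
            simp only
            nlinarith [sq_nonneg (Z a ω ^ 2 - Z b ω ^ 2)]
      _ ≤ B := by
          rw [integral_const_mul, integral_add (h4 a) (h4 b)]
          linarith [hB a, hB b]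
  have hm' : (m : ℝ) ≠ 0 := by positivity
  have hN' : (0 : ℝ) < N := by positivity
  have key : ∀ a b, Integrable (fun W : Fin N → Ω =>
        ((m : ℝ)⁻¹ * ((N : ℝ)⁻¹ * ∑ j, Z a (W j) * Z b (W j)) - (m : ℝ)⁻¹ * C a b) ^ 2)
        (Measure.pi fun _ => P) ∧
      ∫ W : Fin N → Ω, ((m : ℝ)⁻¹ * ((N : ℝ)⁻¹ * ∑ j, Z a (W j) * Z b (W j)) -
        (m : ℝ)⁻¹ * C a b) ^ 2 ∂(Measure.pi fun _ => P) ≤ ((m : ℝ)⁻¹) ^ 2 * (B / N) :=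
    fun a b => by
      obtain ⟨h1, h2⟩ := integral_empirical_sq_le (hY a b) hN
      rw [hC a b] at h1 h2
      simp only [← mul_sub, mul_pow _ _ 2]
      refine ⟨h1.const_mul _, ?_⟩
      rw [integral_const_mul]
      have := hY2 a b
      gcongr
      exact h2.trans (by gcongr)
  set f : (Fin N → Ω) → ℝ := fun W => ∑ a, ∑ b,
    ((m : ℝ)⁻¹ * ((N : ℝ)⁻¹ * ∑ j, Z a (W j) * Z b (W j)) - (m : ℝ)⁻¹ * C a b) ^ 2 with hf
  have hfi : Integrable f (Measure.pi fun _ => P) :=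
    integrable_finsetSum _ fun a _ => integrable_finsetSum _ fun b _ => (key a b).1
  have hfb : ∫ W, f W ∂(Measure.pi fun _ => P) ≤ B / N := by
    calc _ = ∑ a, ∑ b, ∫ W : Fin N → Ω,
          ((m : ℝ)⁻¹ * ((N : ℝ)⁻¹ * ∑ j, Z a (W j) * Z b (W j)) - (m : ℝ)⁻¹ * C a b) ^ 2
            ∂(Measure.pi fun _ => P) := by
          rw [hf, integral_finsetSum _ fun a _ =>
            integrable_finsetSum _ fun b _ => (key a b).1]
          refine Finset.sum_congr rfl fun a _ => ?_
          rw [integral_finsetSum _ fun b _ => (key a b).1]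
      _ ≤ ∑ _a : Fin m, ∑ _b : Fin m, ((m : ℝ)⁻¹) ^ 2 * (B / N) :=
          Finset.sum_le_sum fun a _ => Finset.sum_le_sum fun b _ => (key a b).2
      _ = B / N := by simp; field_simp
  have hmk := mul_meas_ge_le_integral_of_nonneg
    (ae_of_all _ fun W => by simp only [hf, Pi.zero_apply]; positivity) hfi (2 * B / (N * δ))
  rw [← ENNReal.ofReal_toReal (measure_ne_top (Measure.pi fun _ : Fin N => P) _)]
  refine ENNReal.ofReal_le_ofReal ?_
  rw [← measureReal_def]
  have h5 := hmk.trans hfb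
  rw [← le_div_iff₀' (by positivity)] at h5
  refine h5.trans (le_of_eq ?_)
  field_simp

/-- Concentration in Frobenius norm of the scaled empirical Gram matrix of a centered Gaussian
process with bounded covariance function. -/
lemma measure_gram_ge_le {T : Type*} {K : T → T → ℝ} {ξ : Ω → T → ℝ}
    (hsymm : ∀ s t, K s t = K t s)
    (hpos : ∀ (n : ℕ) (x : Fin n → T) (c : Fin n → ℝ), 0 ≤ ∑ a, ∑ b, c a * c b * K (x a) (x b))
    {κ : ℝ} (hκ : 0 < κ) (hbound : ∀ x, K x x ≤ κ ^ 2)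
    (hmeas : ∀ t, Measurable fun ω => ξ ω t)
    (hGauss : ∀ (n : ℕ) (x : Fin n → T) (a : Fin n → ℝ),
      P.map (fun ω => ∑ i, a i * ξ ω (x i)) =
        gaussianReal 0 (∑ i, ∑ j, a i * a j * K (x i) (x j)).toNNReal)
    {m : ℕ} (hm : 0 < m) (X : Fin m → T) {N : ℕ} (hN : 0 < N) {δ : ℝ} (hδ : 0 < δ) :
    (Measure.pi fun _ : Fin N => P) {W | 2 * (96 * κ ^ 4) / (N * δ) ≤
      ∑ a, ∑ b, ((m : ℝ)⁻¹ * ((N : ℝ)⁻¹ * ∑ j, ξ (W j) (X a) * ξ (W j) (X b)) -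
        (m : ℝ)⁻¹ * K (X a) (X b)) ^ 2} ≤ ENNReal.ofReal (δ / 2) := by
  have hlaw : ∀ u, P.map (fun ω => ξ ω u) = gaussianReal 0 (K u u).toNNReal := fun u => by
    have h := hGauss 1 (fun _ => u) (fun _ => 1)
    simpa only [Finset.univ_unique, Finset.sum_singleton, one_mul] using h
  refine measure_empirical_covariance_ge_le hm (Z := fun a ω => ξ ω (X a))
    (C := fun a b => K (X a) (X b)) (fun a => memLp_of_gaussian (hmeas _) (hlaw _) 4 (by simp))
    (fun a => integral_pow_four_le_of_gaussian (hmeas _) (hlaw _) hκ ?_) (by positivity)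
    (fun a b => integral_mul_of_gaussian hsymm hpos hmeas hGauss _ _) hN hδ
  rw [Real.coe_toNNReal']
  exact max_le (hbound _) (sq_nonneg κ)

end Probability
lemma posSemidef_smul_gram {T : Type*} {K : T → T → ℝ} (hsymm : ∀ s t, K s t = K t s)
    (hpos : ∀ (n : ℕ) (x : Fin n → T) (c : Fin n → ℝ), 0 ≤ ∑ a, ∑ b, c a * c b * K (x a) (x b))
    {m : ℕ} (X : Fin m → T) :
    ((m : ℝ)⁻¹ • Matrix.of fun a b => K (X a) (X b)).PosSemidef := by
  refine PosSemidef.smul (PosSemidef.of_dotProduct_mulVec_nonneg ?_ fun c => ?_) (by positivity)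
  · ext a b; simp [hsymm (X b)]
  · refine (hpos m X c).trans_eq ?_
    simp only [dotProduct, mulVec, Finset.mul_sum, of_apply, star_trivial]
    exact Finset.sum_congr rfl fun a _ => Finset.sum_congr rfl fun b _ => by ring

lemma posSemidef_smul_empirical {m N : ℕ} (Z : Fin N → Fin m → ℝ) :
    ((m : ℝ)⁻¹ • Matrix.of fun a b => (N : ℝ)⁻¹ * ∑ j, Z j a * Z j b).PosSemidef := by
  refine PosSemidef.smul (PosSemidef.of_dotProduct_mulVec_nonneg ?_ fun c => ?_) (by positivity)
  · ext a b; simp [mul_comm]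
  · have h : star c ⬝ᵥ ((Matrix.of fun a b => (N : ℝ)⁻¹ * ∑ j, Z j a * Z j b) *ᵥ c) =
        (N : ℝ)⁻¹ * ∑ j, (∑ a, c a * Z j a) ^ 2 := by
      simp only [dotProduct, mulVec, sq, Finset.mul_sum, Finset.sum_mul, of_apply, star_trivial]
      rw [Finset.sum_comm_cycle]
      refine Finset.sum_congr rfl fun j _ => ?_
      rw [Finset.sum_comm]
      exact Finset.sum_congr rfl fun a _ => Finset.sum_congr rfl fun b _ => by ring
    rw [h]; positivity

lemma sqrt_mul_sqrt_le_rate {κ : ℝ} (m : ℕ) {N : ℕ} (hN : 0 < N) {δ : ℝ}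
    (hδ0 : 0 < δ) (hδ1 : δ < 1) :
    √m * √(2 * (96 * κ ^ 4) / (N * δ)) ≤ 9 * κ ^ 2 * (4 / (N * δ ^ 2) +
      √m / (√N * δ) * (3 + 4 / (√N * δ))) := by
  have hN' : (0 : ℝ) < N := by positivity
  have h1 : √(2 * (96 * κ ^ 4) / (N * δ)) ≤ 14 * κ ^ 2 / (√N * δ) := by
    refine Real.sqrt_le_iff.2 ⟨by positivity, ?_⟩
    rw [div_pow, mul_pow, mul_pow, Real.sq_sqrt hN'.le, div_le_div_iff₀ (by positivity)
      (by positivity)]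
    have h2 : δ ^ 2 ≤ δ := by nlinarith
    have h3 : 0 ≤ κ ^ 4 * N := by positivity
    nlinarith [mul_le_mul_of_nonneg_left h2 h3, mul_nonneg h3 hδ0.le]
  have h4 : 0 ≤ κ ^ 2 * (√m / (√N * δ)) := by positivity
  have h5 : 0 ≤ κ ^ 2 * (4 / (N * δ ^ 2)) := by positivity
  have h6 : 0 ≤ κ ^ 2 * (√m / (√N * δ)) * (4 / (√N * δ)) := by positivity
  calc _ ≤ √m * (14 * κ ^ 2 / (√N * δ)) := by gcongr
    _ = 14 * (κ ^ 2 * (√m / (√N * δ))) := by ring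
    _ ≤ _ := by nlinarith

/-- A Frobenius bound on the distance of two matrices bounds the distance of their square roots. -/
lemma sqrt_trace_sub_le {m N : ℕ} (hN : 0 < N) {δ κ : ℝ} (hδ0 : 0 < δ) (hδ1 : δ < 1)
    (hκ : 0 < κ) {P P' : Matrix (Fin m) (Fin m) ℝ} (hP : P.PosSemidef) (hP' : P'.PosSemidef)
    (h : ((P' * P' - P * P) * (P' * P' - P * P)ᵀ).trace ≤ 2 * (96 * κ ^ 4) / (N * δ)) :
    √((P' - P) * (P' - P)ᵀ).trace ≤
      3 * κ * √(4 / (N * δ ^ 2) + √m / (√N * δ) * (3 + 4 / (√N * δ))) := by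
  refine Real.sqrt_le_iff.2 ⟨by positivity, (trace_sub_sq_le hP hP').trans ?_⟩
  rw [Fintype.card_fin, mul_pow, mul_pow, Real.sq_sqrt (by positivity)]
  refine (mul_le_mul_of_nonneg_left (Real.sqrt_le_sqrt h) (Real.sqrt_nonneg _)).trans ?_
  norm_num only
  exact (sqrt_mul_sqrt_le_rate m hN hδ0 hδ1).trans_eq' (by norm_num)

lemma trace_sub_eq_sum {m N : ℕ} (Z : Fin N → Fin m → ℝ) (C : Fin m → Fin m → ℝ) :
    ((((m : ℝ)⁻¹ • Matrix.of fun a b => (N : ℝ)⁻¹ * ∑ j, Z j a * Z j b) -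
        (m : ℝ)⁻¹ • Matrix.of fun a b => C a b) *
      (((m : ℝ)⁻¹ • Matrix.of fun a b => (N : ℝ)⁻¹ * ∑ j, Z j a * Z j b) -
        (m : ℝ)⁻¹ • Matrix.of fun a b => C a b)ᵀ).trace =
    ∑ a, ∑ b, ((m : ℝ)⁻¹ * ((N : ℝ)⁻¹ * ∑ j, Z j a * Z j b) - (m : ℝ)⁻¹ * C a b) ^ 2 := by
  rw [trace_mul_transpose_eq]
  simp [sq]

/-- A measurable event pulled back along i.i.d. sampling of one marginal keeps its measure. -/
lemma measure_pi_preimage_eq {α β : Type*} [MeasurableSpace α] [MeasurableSpace β]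
    {μ : Measure α} {ν : Measure β} [IsProbabilityMeasure μ] [IsProbabilityMeasure ν]
    {f : α → β} (hf : MeasurePreserving f μ ν) {N : ℕ} {s : Set (Fin N → β)}
    (hs : MeasurableSet s) :
    (Measure.pi fun _ : Fin N => μ) {W | (fun j => f (W j)) ∈ s} =
      (Measure.pi fun _ : Fin N => ν) s :=
  (measurePreserving_pi (fun _ => μ) (fun _ => ν) fun _ => hf).measure_preimage
    hs.nullMeasurableSet

end BuresWasserstein

theorem wasserstein_empirical_vs_true_gram_concentration
    {T : Type*} [MetricSpace T] [SigmaCompactSpace T]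
    (K1 K2 : T → T → ℝ)
    (hK1cont : Continuous fun p : T × T => K1 p.1 p.2)
    (hK2cont : Continuous fun p : T × T => K2 p.1 p.2)
    (hK1symm : ∀ s t, K1 s t = K1 t s) (hK2symm : ∀ s t, K2 s t = K2 t s)
    (hK1pos : ∀ (n : ℕ) (x : Fin n → T) (c : Fin n → ℝ),
      0 ≤ ∑ a, ∑ b, c a * c b * K1 (x a) (x b))
    (hK2pos : ∀ (n : ℕ) (x : Fin n → T) (c : Fin n → ℝ),
      0 ≤ ∑ a, ∑ b, c a * c b * K2 (x a) (x b))
    (κ1 κ2 : ℝ) (hκ1 : 0 < κ1) (hκ2 : 0 < κ2)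
    (hbound1 : ∀ x, K1 x x ≤ κ1 ^ 2) (hbound2 : ∀ x, K2 x x ≤ κ2 ^ 2)
    {Ω1 Ω2 : Type*} [MeasurableSpace Ω1] [MeasurableSpace Ω2]
    (P1 : Measure Ω1) [IsProbabilityMeasure P1]
    (P2 : Measure Ω2) [IsProbabilityMeasure P2]
    (ξ1 : Ω1 → T → ℝ) (ξ2 : Ω2 → T → ℝ)
    (hmeas1 : ∀ t, Measurable fun ω => ξ1 ω t) (hmeas2 : ∀ t, Measurable fun ω => ξ2 ω t)
    (hGauss1 : ∀ (n : ℕ) (x : Fin n → T) (a : Fin n → ℝ),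
      Measure.map (fun ω => ∑ i, a i * ξ1 ω (x i)) P1 =
        gaussianReal 0 (∑ i, ∑ j, a i * a j * K1 (x i) (x j)).toNNReal)
    (hGauss2 : ∀ (n : ℕ) (x : Fin n → T) (a : Fin n → ℝ),
      Measure.map (fun ω => ∑ i, a i * ξ2 ω (x i)) P2 =
        gaussianReal 0 (∑ i, ∑ j, a i * a j * K2 (x i) (x j)).toNNReal)
    (m : ℕ) (hm : 0 < m) (X : Fin m → T)
    (N : ℕ) (hN : 0 < N)
    (δ : ℝ) (hδ0 : 0 < δ) (hδ1 : δ < 1) :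
    ENNReal.ofReal (1 - δ) ≤
      (Measure.pi fun _ : Fin N => P1.prod P2) {W : Fin N → Ω1 × Ω2 |
        ∀ Q1 QM P1' PM : Matrix (Fin m) (Fin m) ℝ,
          Q1.PosSemidef →
          Q1 * Q1 = (m : ℝ)⁻¹ • Matrix.of (fun a b =>
            (N : ℝ)⁻¹ * ∑ j, ξ1 (W j).1 (X a) * ξ1 (W j).1 (X b)) →
          QM.PosSemidef →
          QM * QM = Q1 * ((m : ℝ)⁻¹ • Matrix.of (fun a b =>
            (N : ℝ)⁻¹ * ∑ j, ξ2 (W j).2 (X a) * ξ2 (W j).2 (X b))) * Q1 →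
          P1'.PosSemidef →
          P1' * P1' = (m : ℝ)⁻¹ • Matrix.of (fun a b => K1 (X a) (X b)) →
          PM.PosSemidef →
          PM * PM = P1' * ((m : ℝ)⁻¹ • Matrix.of (fun a b => K2 (X a) (X b))) * P1' →
          |Real.sqrt
              (((m : ℝ)⁻¹ • Matrix.of (fun a b =>
                  (N : ℝ)⁻¹ * ∑ j, ξ1 (W j).1 (X a) * ξ1 (W j).1 (X b))).trace +
                ((m : ℝ)⁻¹ • Matrix.of (fun a b =>
                  (N : ℝ)⁻¹ * ∑ j, ξ2 (W j).2 (X a) * ξ2 (W j).2 (X b))).trace -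
                2 * QM.trace) -
            Real.sqrt
              (((m : ℝ)⁻¹ • Matrix.of (fun a b => K1 (X a) (X b))).trace +
                ((m : ℝ)⁻¹ • Matrix.of (fun a b => K2 (X a) (X b))).trace -
                2 * PM.trace)| ≤
          3 * (κ1 + κ2) *
            Real.sqrt (4 / (N * δ ^ 2) +
              Real.sqrt m / (Real.sqrt N * δ) * (3 + 4 / (Real.sqrt N * δ))) } := by
  set F1 : (Fin N → Ω1) → ℝ := fun W => ∑ a, ∑ b,
    ((m : ℝ)⁻¹ * ((N : ℝ)⁻¹ * ∑ j, ξ1 (W j) (X a) * ξ1 (W j) (X b)) -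
      (m : ℝ)⁻¹ * K1 (X a) (X b)) ^ 2 with hF1
  set F2 : (Fin N → Ω2) → ℝ := fun W => ∑ a, ∑ b,
    ((m : ℝ)⁻¹ * ((N : ℝ)⁻¹ * ∑ j, ξ2 (W j) (X a) * ξ2 (W j) (X b)) -
      (m : ℝ)⁻¹ * K2 (X a) (X b)) ^ 2 with hF2
  have hF1m : Measurable F1 := by
    have h (a : Fin m) (j : Fin N) : Measurable fun W : Fin N → Ω1 => ξ1 (W j) (X a) :=
      (hmeas1 (X a)).comp (measurable_pi_apply j)
    fun_prop
  have hF2m : Measurable F2 := by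
    have h (a : Fin m) (j : Fin N) : Measurable fun W : Fin N → Ω2 => ξ2 (W j) (X a) :=
      (hmeas2 (X a)).comp (measurable_pi_apply j)
    fun_prop
  set s1 := {W | 2 * (96 * κ1 ^ 4) / (N * δ) ≤ F1 W} with hs1
  set s2 := {W | 2 * (96 * κ2 ^ 4) / (N * δ) ≤ F2 W} with hs2
  have hs1m : MeasurableSet s1 := measurableSet_le measurable_const hF1m
  have hs2m : MeasurableSet s2 := measurableSet_le measurable_const hF2m
  have hb1 := (BuresWasserstein.measure_pi_preimage_eq (N := N)
    (measurePreserving_fst (μ := P1) (ν := P2)) hs1m).trans_le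
    (BuresWasserstein.measure_gram_ge_le hK1symm hK1pos hκ1 hbound1 hmeas1 hGauss1 hm X hN hδ0)
  have hb2 := (BuresWasserstein.measure_pi_preimage_eq (N := N)
    (measurePreserving_snd (μ := P1) (ν := P2)) hs2m).trans_le
    (BuresWasserstein.measure_gram_ge_le hK2symm hK2pos hκ2 hbound2 hmeas2 hGauss2 hm X hN hδ0)
  set b1 : Set (Fin N → Ω1 × Ω2) := {W | (fun j => (W j).1) ∈ s1}
  set b2 : Set (Fin N → Ω1 × Ω2) := {W | (fun j => (W j).2) ∈ s2}
  have hb1m : MeasurableSet b1 := hs1m.preimage (by fun_prop)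
  have hb2m : MeasurableSet b2 := hs2m.preimage (by fun_prop)
  have hgood : ENNReal.ofReal (1 - δ) ≤ (Measure.pi fun _ : Fin N => P1.prod P2) (b1 ∪ b2)ᶜ := by
    rw [prob_compl_eq_one_sub (hb1m.union hb2m), ENNReal.ofReal_sub _ hδ0.le, ENNReal.ofReal_one]
    refine tsub_le_tsub_left ((measure_union_le _ _).trans ((add_le_add hb1 hb2).trans ?_)) _
    rw [← ENNReal.ofReal_add (by positivity) (by positivity), add_halves]
  refine hgood.trans (measure_mono fun W hW => ?_)
  obtain ⟨hW1, hW2⟩ := not_or.1 hW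
  have hW1 : F1 (fun j => (W j).1) ≤ _ := (not_le.1 hW1).le
  have hW2 : F2 (fun j => (W j).2) ≤ _ := (not_le.1 hW2).le
  intro Q1 QM P1' PM hQ1 hQ1e hQM hQMe hP1 hP1e hPM hPMe
  obtain ⟨Q2, hQ2, hQ2e⟩ := BuresWasserstein.exists_posSemidef_sqrt
    (BuresWasserstein.posSemidef_smul_empirical fun j a => ξ2 (W j).2 (X a))
  obtain ⟨P2', hP2, hP2e⟩ := BuresWasserstein.exists_posSemidef_sqrt
    (BuresWasserstein.posSemidef_smul_gram hK2symm hK2pos X)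
  simp only [hF1] at hW1
  rw [← BuresWasserstein.trace_sub_eq_sum (fun j a => ξ1 (W j).1 (X a))
    (fun a b => K1 (X a) (X b)), ← hQ1e, ← hP1e] at hW1
  simp only [hF2] at hW2
  rw [← BuresWasserstein.trace_sub_eq_sum (fun j a => ξ2 (W j).2 (X a))
    (fun a b => K2 (X a) (X b)), ← hQ2e, ← hP2e] at hW2
  rw [← hQ2e] at hQMe
  rw [← hP2e] at hPMe
  rw [← hQ1e, ← hQ2e, ← hP1e, ← hP2e]
  have d1 := BuresWasserstein.sqrt_trace_sub_le hN hδ0 hδ1 hκ1 hP1 hQ1 hW1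
  have d2 := BuresWasserstein.sqrt_trace_sub_le hN hδ0 hδ1 hκ2 hP2 hQ2 hW2
  have u1 := BuresWasserstein.sqrt_trace_le hP1.1 hP2.1 hPM hPMe hQ1.1 hQ2.1 hQM hQMe
  have u2 := BuresWasserstein.sqrt_trace_le hQ1.1 hQ2.1 hQM hQMe hP1.1 hP2.1 hPM hPMe
  have hsw (E F : Matrix (Fin m) (Fin m) ℝ) :
      ((E - F) * (E - F).transpose).trace = ((F - E) * (F - E).transpose).trace := by
    rw [← neg_sub F E, Matrix.transpose_neg, neg_mul_neg]
  rw [hsw P1' Q1, hsw P2' Q2] at u2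
  rw [abs_le]
  constructor <;> linarith

end
end
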